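/- arXiv:1307.1980 — 5 statements merged into one kernel-verified Lean document; each statement's English description precedes it below -/
import Mathlib

section
/- There is a constant C > 0 depending only on d such that for every continuous f ∈ H⁰_0, every t > 0, every β > 0 and every x ∈ ℝ^d, |(P_t f)(x) − f(x)| ≤ C·( osc_{B(x,t^β)} f + e^{−t^{2β−1}/4}·f*(x) ), where P_t f(x) := ∫_{ℝ^d} (2πt)^{−d/2} e^{−|x−y|²/(2t)} f(y) dy and osc_Ω f := sup_Ω f − inf_Ω f. Consequently, P_t f converges to f uniformly on every compact subset of ℝ^d as t → 0⁺. -/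
open MeasureTheory Real Set
open scoped ENNReal

noncomputable section

/-- The pointwise maximal heat quantity
`f*_α(x) = sup_{τ>0} (1+τ)^α ∫ (2πτ)^{-d/2} e^{-|x-y|²/(2τ)} |f(y)| dy ∈ [0,∞]`. -/
def fstar {d : ℕ} (α : ℝ) (f : EuclideanSpace ℝ (Fin d) → ℝ)
    (x : EuclideanSpace ℝ (Fin d)) : ℝ≥0∞ :=
  ⨆ τ ∈ Set.Ioi (0:ℝ), ENNReal.ofReal ((1 + τ) ^ α) *
    ∫⁻ y, ENNReal.ofReal ((2 * π * τ) ^ (-(d:ℝ)/2) * Real.exp (-‖x - y‖^2 / (2 * τ)) * |f y|)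

/-- The pointwise maximal-function quantity
`f♯_α(x) = sup_{ρ>0} (1+ρ²)^α ⨍_{B(x,ρ)} |f| ∈ [0,∞]`. -/
def fsharp {d : ℕ} (α : ℝ) (f : EuclideanSpace ℝ (Fin d) → ℝ)
    (x : EuclideanSpace ℝ (Fin d)) : ℝ≥0∞ :=
  ⨆ ρ ∈ Set.Ioi (0:ℝ), ENNReal.ofReal ((1 + ρ ^ 2) ^ α) *
    ((∫⁻ y in Metric.ball x ρ, ENNReal.ofReal |f y|) / volume (Metric.ball x ρ))

/-- The space `H⁰_α`: locally integrable functions with `f*_α(x) < ∞` for every `x`. -/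
def MemH0 {d : ℕ} (α : ℝ) (f : EuclideanSpace ℝ (Fin d) → ℝ) : Prop :=
  LocallyIntegrable f (volume : Measure (EuclideanSpace ℝ (Fin d))) ∧ ∀ x, fstar α f x < ⊤

/-- The heat semigroup `P_t f(x) = ∫ (2πt)^{-d/2} e^{-|x-y|²/(2t)} f(y) dy`. -/
def Pt {d : ℕ} (t : ℝ) (f : EuclideanSpace ℝ (Fin d) → ℝ)
    (x : EuclideanSpace ℝ (Fin d)) : ℝ :=
  ∫ y, (2 * π * t) ^ (-(d:ℝ)/2) * Real.exp (-‖x - y‖^2 / (2 * t)) * f y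


def kk {d : ℕ} (t : ℝ) (z : EuclideanSpace ℝ (Fin d)) : ℝ :=
  (2 * π * t) ^ (-(d:ℝ)/2) * Real.exp (-‖z‖^2 / (2 * t))

lemma kk_nonneg {d : ℕ} {t : ℝ} (ht : 0 < t) (z : EuclideanSpace ℝ (Fin d)) : 0 ≤ kk t z := by
  unfold kk; positivity

lemma kk_int0 {d : ℕ} {t : ℝ} (ht : 0 < t) :
    ∫ z : EuclideanSpace ℝ (Fin d), kk t z = 1 := by
  unfold kk
  rw [integral_const_mul]
  have h := GaussianFourier.integral_rexp_neg_mul_sq_norm (V := EuclideanSpace ℝ (Fin d))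
    (b := 1 / (2 * t)) (by positivity)
  have e : ∀ z : EuclideanSpace ℝ (Fin d), -‖z‖^2 / (2 * t) = -(1/(2*t)) * ‖z‖^2 := by
    intro z; ring
  simp_rw [e]
  rw [h]
  have : π / (1 / (2 * t)) = 2 * π * t := by field_simp
  rw [this, finrank_euclideanSpace, Fintype.card_fin, ← Real.rpow_add (by positivity)]
  have : -(d:ℝ)/2 + (d:ℝ)/2 = 0 := by ring
  rw [this, Real.rpow_zero]

lemma kk_int {d : ℕ} {t : ℝ} (ht : 0 < t) (x : EuclideanSpace ℝ (Fin d)) :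
    ∫ y, kk t (x - y) = 1 := by
  rw [integral_sub_left_eq_self (fun z => kk t z) volume x, kk_int0 ht]

lemma kk_integrable {d : ℕ} {t : ℝ} (ht : 0 < t) (x : EuclideanSpace ℝ (Fin d)) :
    Integrable (fun y => kk t (x - y)) := by
  by_contra h
  have := integral_undef h
  rw [kk_int ht] at this
  exact one_ne_zero this

lemma kk_cont {d : ℕ} (t : ℝ) (x : EuclideanSpace ℝ (Fin d)) :
    Continuous (fun y => kk t (x - y)) := by
  unfold kk; fun_prop

lemma fstar_ge {d : ℕ} {f : EuclideanSpace ℝ (Fin d) → ℝ} {t : ℝ} (ht : 0 < t)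
    (x : EuclideanSpace ℝ (Fin d)) :
    ∫⁻ y, ENNReal.ofReal (kk t (x - y) * |f y|) ≤ fstar 0 f x := by
  unfold fstar
  refine le_trans ?_ (le_iSup₂ (f := fun (τ : ℝ) (_ : τ ∈ Set.Ioi (0:ℝ)) =>
    ENNReal.ofReal ((1 + τ) ^ (0:ℝ)) *
    ∫⁻ y, ENNReal.ofReal ((2 * π * τ) ^ (-(d:ℝ)/2) * Real.exp (-‖x - y‖^2 / (2 * τ)) * |f y|)) t ht)
  simp [kk]

lemma kf_abs_integrable {d : ℕ} {f : EuclideanSpace ℝ (Fin d) → ℝ} (hf : Continuous f)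
    (hm : MemH0 0 f) {t : ℝ} (ht : 0 < t) (x : EuclideanSpace ℝ (Fin d)) :
    Integrable (fun y => kk t (x - y) * |f y|) := by
  refine ⟨((kk_cont t x).mul hf.abs).aestronglyMeasurable, ?_⟩
  rw [hasFiniteIntegral_iff_ofReal
    (Filter.Eventually.of_forall fun y => mul_nonneg (kk_nonneg ht _) (abs_nonneg _))]
  exact (fstar_ge ht x).trans_lt (hm.2 x)

lemma kf_integrable {d : ℕ} {f : EuclideanSpace ℝ (Fin d) → ℝ} (hf : Continuous f)
    (hm : MemH0 0 f) {t : ℝ} (ht : 0 < t) (x : EuclideanSpace ℝ (Fin d)) :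
    Integrable (fun y => kk t (x - y) * f y) := by
  refine (kf_abs_integrable hf hm ht x).mono ((kk_cont t x).mul hf).aestronglyMeasurable ?_
  exact Filter.Eventually.of_forall fun y => by simp

lemma kf_abs_le {d : ℕ} {f : EuclideanSpace ℝ (Fin d) → ℝ} (hf : Continuous f)
    (hm : MemH0 0 f) {t : ℝ} (ht : 0 < t) (x : EuclideanSpace ℝ (Fin d)) :
    ∫ y, kk t (x - y) * |f y| ≤ (fstar 0 f x).toReal := by
  rw [integral_eq_lintegral_of_nonneg_ae
    (Filter.Eventually.of_forall fun y => mul_nonneg (kk_nonneg ht _) (abs_nonneg _))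
    ((kk_cont t x).mul hf.abs).aestronglyMeasurable]
  exact ENNReal.toReal_mono (hm.2 x).ne (fstar_ge ht x)

lemma Pt_eq {d : ℕ} (f : EuclideanSpace ℝ (Fin d) → ℝ) (t : ℝ) (x : EuclideanSpace ℝ (Fin d)) :
    Pt t f x = ∫ y, kk t (x - y) * f y := rfl

lemma Pt_abs_le {d : ℕ} {f : EuclideanSpace ℝ (Fin d) → ℝ} (hf : Continuous f)
    (hm : MemH0 0 f) {t : ℝ} (ht : 0 < t) (x : EuclideanSpace ℝ (Fin d)) :
    |Pt t f x| ≤ (fstar 0 f x).toReal := by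
  rw [Pt_eq]
  refine (abs_integral_le_integral_abs).trans (le_trans (le_of_eq ?_) (kf_abs_le hf hm ht x))
  congr 1; ext y; rw [abs_mul, abs_of_nonneg (kk_nonneg ht _)]

/-- master estimate -/
lemma master {d : ℕ} {f : EuclideanSpace ℝ (Fin d) → ℝ} (hf : Continuous f)
    (hm : MemH0 0 f) {t : ℝ} (ht : 0 < t) (x : EuclideanSpace ℝ (Fin d)) (M : ℝ)
    (g : EuclideanSpace ℝ (Fin d) → ℝ) (hg : Integrable g)
    (h : ∀ y, kk t (x - y) * |f y - f x| ≤ M * kk t (x - y) + g y) :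
    |Pt t f x - f x| ≤ M + ∫ y, g y := by
  have h1 : Pt t f x - f x = ∫ y, kk t (x - y) * (f y - f x) := by
    simp_rw [mul_sub]
    rw [integral_sub (kf_integrable hf hm ht x) ((kk_integrable ht x).mul_const _),
      integral_mul_const, kk_int ht, one_mul, Pt_eq]
  have h2 : M + ∫ y, g y = ∫ y, (M * kk t (x - y) + g y) := by
    rw [integral_add ((kk_integrable ht x).const_mul _) hg, integral_const_mul, kk_int ht, mul_one]
  rw [h1, h2]
  refine abs_integral_le_integral_abs.trans ?_
  have hi : Integrable (fun y => kk t (x - y) * (f y - f x)) := by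
    simp_rw [mul_sub]
    exact (kf_integrable hf hm ht x).sub ((kk_integrable ht x).mul_const _)
  refine integral_mono hi.abs (((kk_integrable ht x).const_mul _).add hg) fun y => ?_
  simp only [abs_mul, abs_of_nonneg (kk_nonneg ht _)]
  exact h y

lemma kk_two {d : ℕ} {t δ : ℝ} (ht : 0 < t) (hδ : 0 ≤ δ) (z : EuclideanSpace ℝ (Fin d))
    (hz : δ ≤ ‖z‖) :
    kk t z ≤ 2 ^ ((d:ℝ)/2) * Real.exp (-δ^2/(4*t)) * kk (2*t) z := by
  unfold kk
  have e1 : (2 * π * (2 * t)) ^ (-(d:ℝ)/2) = 2 ^ (-(d:ℝ)/2) * (2 * π * t) ^ (-(d:ℝ)/2) := by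
    rw [← Real.mul_rpow (by norm_num) (by positivity)]; congr 1; ring
  have e2 : (2:ℝ) ^ ((d:ℝ)/2) * 2 ^ (-(d:ℝ)/2) = 1 := by
    rw [← Real.rpow_add (by norm_num)]
    have : (d:ℝ)/2 + -(d:ℝ)/2 = 0 := by ring
    rw [this, Real.rpow_zero]
  have e3 : Real.exp (-‖z‖^2 / (2 * t)) ≤
      Real.exp (-δ^2/(4*t)) * Real.exp (-‖z‖^2 / (2 * (2*t))) := by
    rw [← Real.exp_add, Real.exp_le_exp]
    have h1 : -‖z‖^2 / (2 * t) = -‖z‖^2/(4*t) + -‖z‖^2 / (2 * (2*t)) := by field_simp; ring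
    rw [h1]
    gcongr
  calc _ ≤ (2 * π * t) ^ (-(d:ℝ)/2) *
        (Real.exp (-δ^2/(4*t)) * Real.exp (-‖z‖^2 / (2 * (2*t)))) := by gcongr
    _ = ((2:ℝ) ^ ((d:ℝ)/2) * 2 ^ (-(d:ℝ)/2)) * ((2 * π * t) ^ (-(d:ℝ)/2) *
        (Real.exp (-δ^2/(4*t)) * Real.exp (-‖z‖^2 / (2 * (2*t))))) := by rw [e2, one_mul]
    _ = _ := by rw [e1]; ring

lemma estA {d : ℕ} {f : EuclideanSpace ℝ (Fin d) → ℝ} (hf : Continuous f)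
    (hm : MemH0 0 f) {t δ : ℝ} (ht : 0 < t) (hδ : 0 ≤ δ) (x : EuclideanSpace ℝ (Fin d)) (M : ℝ)
    (hM0 : 0 ≤ M) (hM : ∀ y ∈ Metric.ball x δ, |f y - f x| ≤ M) :
    |Pt t f x - f x| ≤ M + 2 ^ ((d:ℝ)/2) * Real.exp (-δ^2/(4*t)) *
      ((fstar 0 f x).toReal + |f x|) := by
  have ht2 : 0 < 2 * t := by positivity
  have hi : Integrable (fun y => kk (2*t) (x - y) * |f y| + kk (2*t) (x - y) * |f x|) :=
    (kf_abs_integrable hf hm ht2 x).add ((kk_integrable ht2 x).mul_const _)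
  refine (master hf hm ht x M (fun y => (2 ^ ((d:ℝ)/2) * Real.exp (-δ^2/(4*t))) *
    (kk (2*t) (x - y) * |f y| + kk (2*t) (x - y) * |f x|)) (hi.const_mul _) ?_).trans ?_
  · intro y
    have k1 := kk_nonneg ht (x - y)
    have k2 := kk_nonneg ht2 (x - y)
    by_cases hy : y ∈ Metric.ball x δ
    · have := mul_le_mul_of_nonneg_left (hM y hy) k1
      have : 0 ≤ (2 ^ ((d:ℝ)/2) * Real.exp (-δ^2/(4*t))) *
        (kk (2*t) (x - y) * |f y| + kk (2*t) (x - y) * |f x|) := by positivity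
      linarith
    · have hz : δ ≤ ‖x - y‖ := by
        rw [Metric.mem_ball, not_lt, dist_comm, dist_eq_norm] at hy; exact hy
      have a := kk_two ht hδ (x - y) hz
      have b : kk t (x - y) * |f y - f x| ≤
        2 ^ ((d:ℝ)/2) * Real.exp (-δ^2/(4*t)) * kk (2*t) (x - y) * (|f y| + |f x|) := by
        gcongr
        exact abs_sub _ _
      have : 0 ≤ M * kk t (x - y) := by positivity
      linarith
  · rw [integral_const_mul, integral_add (kf_abs_integrable hf hm ht2 x)
      ((kk_integrable ht2 x).mul_const _), integral_mul_const, kk_int ht2, one_mul]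
    have := kf_abs_le hf hm ht2 x
    gcongr

lemma tend1 {δ : ℝ} (hδ : 0 < δ) (s : ℝ) :
    Filter.Tendsto (fun t : ℝ => t ^ (-s) * Real.exp (-δ^2/(4*t))) (nhdsWithin 0 (Set.Ioi 0))
      (nhds 0) := by
  have h := (tendsto_rpow_mul_exp_neg_mul_atTop_nhds_zero s (δ^2/4) (by positivity)).comp
    (tendsto_inv_nhdsGT_zero (𝕜 := ℝ))
  refine h.congr' ?_
  filter_upwards [self_mem_nhdsWithin] with t ht
  have ht : 0 < t := ht
  simp only [Function.comp]
  rw [Real.inv_rpow ht.le, Real.rpow_neg ht.le]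
  congr 2
  field_simp

lemma f_le {d : ℕ} {f : EuclideanSpace ℝ (Fin d) → ℝ} (hf : Continuous f)
    (hm : MemH0 0 f) (x : EuclideanSpace ℝ (Fin d)) : |f x| ≤ (fstar 0 f x).toReal := by
  refine le_of_forall_pos_le_add fun ε hε => ?_
  obtain ⟨δ, hδ, h⟩ := Metric.continuous_iff.1 hf x ε hε
  have key : ∀ t > (0:ℝ), |f x| ≤ (fstar 0 f x).toReal + ε + 2 ^ ((d:ℝ)/2) *
      (t ^ (-(0:ℝ)) * Real.exp (-δ^2/(4*t))) * ((fstar 0 f x).toReal + |f x|) := by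
    intro t ht
    have a := estA hf hm ht hδ.le x ε hε.le (fun y hy => (h y hy).le)
    have b := Pt_abs_le hf hm ht x
    have c : |f x| ≤ |Pt t f x| + |Pt t f x - f x| := by
      have := abs_sub (Pt t f x) (Pt t f x - f x)
      simpa using this
    simp only [neg_zero, Real.rpow_zero, one_mul]
    linarith
  have T := (((tend1 hδ 0).const_mul ((2:ℝ) ^ ((d:ℝ)/2))).mul_const
    ((fstar 0 f x).toReal + |f x|)).const_add ((fstar 0 f x).toReal + ε)
  simp only [mul_zero, zero_mul, add_zero] at T
  refine ge_of_tendsto T ?_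
  filter_upwards [self_mem_nhdsWithin] with t ht
  simpa using key t ht

lemma part1 {d : ℕ} {f : EuclideanSpace ℝ (Fin d) → ℝ} (hf : Continuous f)
    (hm : MemH0 0 f) {t : ℝ} (ht : 0 < t) (β : ℝ) (x : EuclideanSpace ℝ (Fin d)) :
    |Pt t f x - f x| ≤ (2 * 2 ^ ((d:ℝ)/2) + 1) *
      ((sSup (f '' Metric.ball x (t ^ β)) - sInf (f '' Metric.ball x (t ^ β))) +
              Real.exp (-(t ^ (2 * β - 1)) / 4) * (fstar 0 f x).toReal) := by
  have hδ : 0 < t ^ β := by positivity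
  have hc := (isCompact_closedBall x (t ^ β)).image hf
  have hs : f '' Metric.ball x (t ^ β) ⊆ f '' Metric.closedBall x (t ^ β) :=
    Set.image_mono Metric.ball_subset_closedBall
  have ba := hc.bddAbove.mono hs
  have bb := hc.bddBelow.mono hs
  have up : ∀ y ∈ Metric.ball x (t ^ β), f y ≤ sSup (f '' Metric.ball x (t ^ β)) :=
    fun y hy => le_csSup ba ⟨y, hy, rfl⟩
  have lo : ∀ y ∈ Metric.ball x (t ^ β), sInf (f '' Metric.ball x (t ^ β)) ≤ f y :=
    fun y hy => csInf_le bb ⟨y, hy, rfl⟩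
  have hx : x ∈ Metric.ball x (t ^ β) := Metric.mem_ball_self hδ
  have h0 : 0 ≤ sSup (f '' Metric.ball x (t ^ β)) - sInf (f '' Metric.ball x (t ^ β)) := by
    linarith [up x hx, lo x hx]
  have a := estA hf hm ht hδ.le x _ h0 (fun y hy => by
    rw [abs_le]; constructor <;> linarith [up x hx, lo x hx, up y hy, lo y hy])
  have e : -(t ^ β)^2/(4*t) = -(t ^ (2 * β - 1)) / 4 := by
    rw [Real.rpow_sub ht, Real.rpow_one, mul_comm 2 β, Real.rpow_mul ht.le, Real.rpow_two]
    field_simp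
  rw [e] at a
  have b := f_le hf hm x
  set O := sSup (f '' Metric.ball x (t ^ β)) - sInf (f '' Metric.ball x (t ^ β))
  set F := (fstar 0 f x).toReal
  have hF : 0 ≤ F := ENNReal.toReal_nonneg
  set E := Real.exp (-(t ^ (2 * β - 1)) / 4)
  have hE : 0 < E := Real.exp_pos _
  have hq : (0:ℝ) < 2 ^ ((d:ℝ)/2) := by positivity
  set q : ℝ := 2 ^ ((d:ℝ)/2)
  have h3 : q * E * (F + |f x|) ≤ q * E * (F + F) := by gcongr
  have h4 : 0 ≤ q * O := by positivity
  have h5 : 0 ≤ E * F := by positivity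
  nlinarith

lemma part2 {d : ℕ} {f : EuclideanSpace ℝ (Fin d) → ℝ} (hf : Continuous f)
    (hm : MemH0 0 f) (K : Set (EuclideanSpace ℝ (Fin d))) (hK : IsCompact K) :
    TendstoUniformlyOn (fun t x => Pt t f x) f (nhdsWithin 0 (Set.Ioi (0:ℝ))) K := by
  rw [Metric.tendstoUniformlyOn_iff]
  intro ε hε
  have hu := hK.uniformContinuousAt_of_continuousAt f (fun x _ => hf.continuousAt)
    (Metric.dist_mem_uniformity (half_pos hε))
  obtain ⟨δ, hδ, hu⟩ := Metric.mem_uniformity_dist.1 hu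
  obtain ⟨R, hR⟩ := hK.isBounded.exists_norm_le
  obtain ⟨B, hB⟩ := hK.exists_bound_of_continuousOn hf.continuousOn
  have h4 : (0:ℝ) < 4 := by norm_num
  have I1 := kf_abs_integrable hf hm h4 0
  have I2 := (kk_integrable (d := d) h4 0).mul_const |B|
  have hi := I1.add I2
  set c4 : ℝ := (2 * π * 4) ^ (-(d:ℝ)/2) with hc4
  have hc4p : 0 < c4 := by positivity
  set A : ℝ := ∫ y, (kk 4 (0 - y) * |f y| + kk 4 (0 - y) * |B|) with hA
  set D : ℝ := (2 * π) ^ (-(d:ℝ)/2) * Real.exp (R^2/4) * c4⁻¹ with hD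
  have hDp : 0 < D := by positivity
  have T := ((tend1 hδ ((d:ℝ)/2)).const_mul D).mul_const A
  simp only [mul_zero, zero_mul] at T
  have T' := T.eventually (gt_mem_nhds (half_pos hε))
  filter_upwards [T', self_mem_nhdsWithin, Ioc_mem_nhdsGT (zero_lt_one' ℝ)] with t hT ht0 ht1 x hx
  have ht : 0 < t := ht0
  have ht1 : t ≤ 1 := ht1.2
  rw [dist_comm, Real.dist_eq]
  set G : ℝ := D * (t ^ (-((d:ℝ)/2)) * Real.exp (-δ^2/(4*t))) with hG
  have hGp : 0 < G := by positivity
  have := master hf hm ht x (ε/2)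
    (fun y => G * (kk 4 (0 - y) * |f y| + kk 4 (0 - y) * |B|)) (hi.const_mul _) ?_
  · rw [integral_const_mul] at this
    linarith
  intro y
  have k1 := kk_nonneg ht (x - y)
  have k4 := kk_nonneg h4 (0 - y)
  by_cases hy : dist x y < δ
  · have h1 : dist (f x) (f y) < ε/2 := hu hy hx
    rw [dist_comm, Real.dist_eq] at h1
    have := mul_le_mul_of_nonneg_left h1.le k1
    have : 0 ≤ G * (kk 4 (0 - y) * |f y| + kk 4 (0 - y) * |B|) := by positivity
    linarith
  · rw [not_lt, dist_eq_norm] at hy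
    have key : kk t (x - y) ≤ G * kk 4 (0 - y) := by
      have e0 : (2 * π * t) ^ (-(d:ℝ)/2) = (2 * π) ^ (-(d:ℝ)/2) * t ^ (-((d:ℝ)/2)) := by
        rw [Real.mul_rpow (by positivity) ht.le, neg_div]
      have e1 : Real.exp (-‖x - y‖^2 / (2 * t)) ≤
          Real.exp (-δ^2/(4*t)) * (Real.exp (R^2/4) * Real.exp (-‖0 - y‖^2/(2*4))) := by
        rw [← Real.exp_add, ← Real.exp_add, Real.exp_le_exp, zero_sub, norm_neg]
        have h1 : -‖x - y‖^2 / (2 * t) = -‖x - y‖^2/(4*t) + -‖x - y‖^2/(4*t) := by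
          field_simp; ring
        have h2 : -‖x - y‖^2/(4*t) ≤ -δ^2/(4*t) := by gcongr
        have h3 : -‖x - y‖^2/(4*t) ≤ -‖x - y‖^2/4 := by
          rw [neg_div, neg_div, neg_le_neg_iff]
          gcongr
          linarith
        have h5 : ‖y‖ ≤ ‖x‖ + ‖x - y‖ := by
          have := norm_sub_le x (x - y)
          simpa using this
        have h6 : ‖y‖^2 ≤ 2 * R^2 + 2 * ‖x - y‖^2 := by
          have := hR x hx
          have h7 : ‖y‖ ≤ R + ‖x - y‖ := by linarith
          have h8 : ‖y‖^2 ≤ (R + ‖x - y‖)^2 := by gcongr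
          nlinarith [sq_nonneg (R - ‖x - y‖)]
        linarith
      unfold kk
      rw [e0, ← hc4, hG, hD]
      calc _ ≤ (2 * π) ^ (-(d:ℝ)/2) * t ^ (-((d:ℝ)/2)) *
          (Real.exp (-δ^2/(4*t)) * (Real.exp (R^2/4) * Real.exp (-‖0 - y‖^2/(2*4)))) := by gcongr
        _ = _ := by field_simp
    have hb : |f y - f x| ≤ |f y| + |B| := by
      have := hB x hx
      rw [Real.norm_eq_abs] at this
      linarith [abs_sub (f y) (f x), le_abs_self B]
    have b : kk t (x - y) * |f y - f x| ≤ G * kk 4 (0 - y) * (|f y| + |B|) := by gcongr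
    have : 0 ≤ ε/2 * kk t (x - y) := by positivity
    linarith

/-- There is `C > 0` depending only on `d` such that for every continuous
`f ∈ H⁰_0`, all `t, β > 0` and all `x`,
`|P_t f(x) - f(x)| ≤ C (osc_{B(x,t^β)} f + e^{-t^{2β-1}/4} f*(x))`; consequently
`P_t f → f` uniformly on compacts as `t → 0⁺`. -/
theorem statement10 {d : ℕ} (hd : 1 ≤ d) :
    ∃ C > (0:ℝ),
      ∀ f : EuclideanSpace ℝ (Fin d) → ℝ, Continuous f → MemH0 0 f →
        (∀ t > (0:ℝ), ∀ β > (0:ℝ), ∀ x,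
          |Pt t f x - f x| ≤
            C * ((sSup (f '' Metric.ball x (t ^ β)) - sInf (f '' Metric.ball x (t ^ β))) +
              Real.exp (-(t ^ (2 * β - 1)) / 4) * (fstar 0 f x).toReal)) ∧
        (∀ K : Set (EuclideanSpace ℝ (Fin d)), IsCompact K →
          TendstoUniformlyOn (fun t x => Pt t f x) f (nhdsWithin 0 (Set.Ioi (0:ℝ))) K) := by
  exact ⟨2 * 2 ^ ((d:ℝ)/2) + 1, by positivity, fun f hf hm =>
    ⟨fun t ht β _ x => part1 hf hm ht β x, fun K hK => part2 hf hm K hK⟩⟩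
end
end

section
/- For every integer d ≥ 1, every k ∈ ℕ and every α ≥ 0 there is a constant C > 0 such that for every f ∈ H⁰_α, every t > 0 and every x ∈ ℝ^d: the function P_t f(x) := ∫_{ℝ^d} (2πt)^{−d/2} e^{−|x−y|²/(2t)} f(y) dy is k times differentiable at x, |∇^k(P_t f)(x)| ≤ C·t^{−α−k/2}·f*_α(x), and (∇^k(P_t f))*_α(x) ≤ C·t^{−k/2}·f*_α(x) (pointwise parabolic estimates). -/
open MeasureTheory Real Set
open scoped ENNReal

noncomputable section

/-- The Gaussian kernel. -/
def gk (d : ℕ) (t : ℝ) (z : EuclideanSpace ℝ (Fin d)) : ℝ :=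
  (2 * π * t) ^ (-(d:ℝ)/2) * Real.exp (-‖z‖^2 / (2 * t))

lemma gk_nonneg {d : ℕ} {t : ℝ} (ht : 0 < t) (z : EuclideanSpace ℝ (Fin d)) : 0 ≤ gk d t z := by
  unfold gk; positivity

lemma gk_contDiff {d : ℕ} (t : ℝ) (n : WithTop ℕ∞) : ContDiff ℝ n (gk d t) := by
  unfold gk
  exact contDiff_const.mul (((contDiff_norm_sq ℝ).neg.div_const _).exp)

lemma gk_continuous {d : ℕ} (t : ℝ) : Continuous (gk d t) := (gk_contDiff t 0).continuous

lemma quad_bound {d : ℕ} {s : ℝ} (hs : 0 < s) (z : EuclideanSpace ℝ (Fin d)) (i : ℕ)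
    (hi : 1 ≤ i) :
    ‖iteratedFDeriv ℝ i (fun z : EuclideanSpace ℝ (Fin d) => -‖z‖^2 / (2 * s^2)) z‖
      ≤ (s⁻¹ * (1 + ‖z‖ / s)) ^ i := by
  have e : (fun z : EuclideanSpace ℝ (Fin d) => -‖z‖^2 / (2 * s^2))
      = fun z => (-(2 * s^2)⁻¹ : ℝ) • ‖z‖^2 := by
    ext z; simp only [smul_eq_mul]; ring
  have hf : fderiv ℝ (fun z : EuclideanSpace ℝ (Fin d) => -‖z‖^2 / (2 * s^2))
      = fun z => (-(s^2)⁻¹ : ℝ) • innerSL ℝ z := by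
    rw [e]
    ext z : 1
    rw [fderiv_fun_const_smul (contDiff_norm_sq ℝ (n := 1)).contDiffAt.differentiableAt_one,
      fderiv_norm_sq_apply, ← Nat.cast_smul_eq_nsmul ℝ, smul_smul]
    congr 1
    push_cast
    field_simp
  obtain ⟨j, rfl⟩ : ∃ j, i = j + 1 := ⟨i - 1, by omega⟩
  rw [← norm_iteratedFDeriv_fderiv, hf]
  rcases j with _ | j
  · simp only [norm_iteratedFDeriv_zero, norm_smul, innerSL_apply_norm, norm_neg, norm_inv, norm_pow,
      Real.norm_eq_abs, abs_of_pos hs]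
    have : (s^2)⁻¹ * ‖z‖ = s⁻¹ * (‖z‖ / s) := by field_simp
    rw [this, zero_add, pow_one]
    gcongr
    linarith
  · have hf2 : fderiv ℝ (fun z : EuclideanSpace ℝ (Fin d) => (-(s^2)⁻¹ : ℝ) • innerSL ℝ z)
      = fun _ => (-(s^2)⁻¹ : ℝ) • innerSL ℝ := by
      ext1 z
      exact ((-(s^2)⁻¹ : ℝ) • innerSL ℝ (E := EuclideanSpace ℝ (Fin d))).hasFDerivAt.fderiv
    rw [← norm_iteratedFDeriv_fderiv, hf2]
    rcases j with _ | j
    · simp only [norm_iteratedFDeriv_zero, norm_smul, norm_neg, norm_inv, norm_pow,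
        Real.norm_eq_abs, abs_of_pos hs]
      have h1 : ‖(innerSL ℝ : EuclideanSpace ℝ (Fin d) →L[ℝ] _)‖ ≤ 1 := norm_innerSL_le ℝ
      calc (s^2)⁻¹ * ‖(innerSL ℝ : EuclideanSpace ℝ (Fin d) →L[ℝ] _)‖ ≤ (s^2)⁻¹ * 1 := by gcongr
        _ = (s⁻¹ * 1) ^ 2 := by ring
        _ ≤ _ := by
          simp only [zero_add, one_add_one_eq_two]
          gcongr
          have : 0 ≤ ‖z‖ / s := by positivity
          linarith
    · rw [iteratedFDeriv_succ_const]
      simp only [Pi.zero_apply, norm_zero]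
      positivity

lemma gk_deriv_bound {d : ℕ} {t : ℝ} (ht : 0 < t) (n : ℕ) (z : EuclideanSpace ℝ (Fin d)) :
    ‖iteratedFDeriv ℝ n (gk d t) z‖ ≤
      ((n.factorial : ℝ)^2 * Real.exp 2 * 2 ^ ((d:ℝ)/2)) * t ^ (-(n:ℝ)/2) * gk d (2*t) z := by
  obtain ⟨s, hs, rfl⟩ : ∃ s : ℝ, 0 < s ∧ t = s^2 :=
    ⟨√t, Real.sqrt_pos.2 ht, (Real.sq_sqrt ht.le).symm⟩
  have h1 : ‖iteratedFDeriv ℝ n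
      (Real.exp ∘ (fun z : EuclideanSpace ℝ (Fin d) => -‖z‖^2 / (2 * s^2))) z‖
      ≤ n.factorial * Real.exp (-‖z‖^2 / (2 * s^2)) * (s⁻¹ * (1 + ‖z‖ / s)) ^ n := by
    refine norm_iteratedFDeriv_comp_le (N := n) Real.contDiff_exp
      ((contDiff_norm_sq ℝ).neg.div_const _) le_rfl z ?_ ?_
    · intro i _
      rw [norm_iteratedFDeriv_eq_norm_iteratedDeriv, iteratedDeriv_eq_iterate, Real.iter_deriv_exp,
        Real.norm_eq_abs, abs_of_pos (Real.exp_pos _)]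
    · intro i hi _
      exact quad_bound hs z i hi
  have e : gk d (s^2) = ((2 * π * s^2) ^ (-(d:ℝ)/2) : ℝ) •
      (Real.exp ∘ (fun z : EuclideanSpace ℝ (Fin d) => -‖z‖^2 / (2 * s^2))) := by
    ext z; simp [gk]
  have hc : ContDiff ℝ n
      (Real.exp ∘ (fun z : EuclideanSpace ℝ (Fin d) => -‖z‖^2 / (2 * s^2))) :=
    Real.contDiff_exp.comp ((contDiff_norm_sq ℝ).neg.div_const _)
  rw [e, iteratedFDeriv_const_smul_apply hc.contDiffAt, norm_smul, Real.norm_eq_abs,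
    abs_of_nonneg (by positivity)]
  have h2 : (1 + ‖z‖ / s) ^ n ≤ n.factorial * (Real.exp 2 * Real.exp (‖z‖^2 / (4 * s^2))) := by
    have hr : 0 ≤ ‖z‖ / s := by positivity
    have := Real.pow_div_factorial_le_exp (1 + ‖z‖ / s) (by positivity) n
    rw [div_le_iff₀ (by positivity), mul_comm] at this
    refine this.trans ?_
    rw [← Real.exp_add]
    refine mul_le_mul_of_nonneg_left (Real.exp_le_exp.2 ?_) (by positivity)
    have : ‖z‖^2 / (4 * s^2) = (‖z‖/s)^2/4 := by field_simp
    rw [this]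
    nlinarith [sq_nonneg (‖z‖/s - 2)]
  have h3 : ((s^2 : ℝ)) ^ (-(n:ℝ)/2) = s⁻¹ ^ n := by
    rw [← Real.rpow_natCast s 2, ← Real.rpow_mul hs.le, inv_pow, ← Real.rpow_natCast s n,
      ← Real.rpow_neg hs.le]
    congr 1; push_cast; ring
  have h4 : (2 * π * (2 * s^2)) ^ (-(d:ℝ)/2) * 2 ^ ((d:ℝ)/2) = (2 * π * s^2) ^ (-(d:ℝ)/2) := by
    have : 2 * π * (2 * s^2) = (2 * π * s^2) * 2 := by ring
    rw [this, Real.mul_rpow (by positivity) (by norm_num), mul_assoc,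
      ← Real.rpow_add (by norm_num)]
    have : -(d:ℝ)/2 + (d:ℝ)/2 = 0 := by ring
    rw [this, Real.rpow_zero, mul_one]
  have h5 : Real.exp (-‖z‖^2 / (2 * s^2)) * Real.exp (‖z‖^2 / (4 * s^2))
      = Real.exp (-‖z‖^2 / (2 * (2 * s^2))) := by
    rw [← Real.exp_add]; congr 1; field_simp; ring
  calc _ ≤ (2 * π * s^2) ^ (-(d:ℝ)/2) *
        (n.factorial * Real.exp (-‖z‖^2 / (2 * s^2)) * (s⁻¹ ^ n *
          (n.factorial * (Real.exp 2 * Real.exp (‖z‖^2 / (4 * s^2)))))) := by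
        gcongr
        refine h1.trans ?_
        rw [mul_pow]
        gcongr
    _ = _ := by
        rw [h3, ← h4, gk, ← h5]; ring

lemma gauss_pos {d : ℕ} {b : ℝ} (hb : 0 < b) (m : EuclideanSpace ℝ (Fin d)) :
    ∫⁻ y : EuclideanSpace ℝ (Fin d), ENNReal.ofReal (Real.exp (-b * ‖y - m‖^2))
      = ENNReal.ofReal ((π / b) ^ ((d:ℝ)/2)) := by
  rw [lintegral_sub_right_eq_self (fun y => ENNReal.ofReal (Real.exp (-b * ‖y‖^2))) m]
  have h := GaussianFourier.integral_rexp_neg_mul_sq_norm (V := EuclideanSpace ℝ (Fin d)) hb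
  rw [finrank_euclideanSpace_fin] at h
  rw [← h, ofReal_integral_eq_lintegral_ofReal]
  · by_contra hi
    rw [integral_undef hi] at h
    have : (0:ℝ) < (π / b) ^ ((d:ℝ)/2) := by positivity
    linarith
  · exact Filter.Eventually.of_forall fun y => (Real.exp_pos _).le

lemma semigroup {d : ℕ} {a b : ℝ} (ha : 0 < a) (hb : 0 < b) (x z : EuclideanSpace ℝ (Fin d)) :
    ∫⁻ y, ENNReal.ofReal (gk d a (x - y)) * ENNReal.ofReal (gk d b (y - z))
      = ENNReal.ofReal (gk d (a + b) (x - z)) := by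
  have key : ∀ y, ENNReal.ofReal (gk d a (x - y)) * ENNReal.ofReal (gk d b (y - z)) =
      ENNReal.ofReal ((2 * π * a) ^ (-(d:ℝ)/2) * (2 * π * b) ^ (-(d:ℝ)/2) *
        Real.exp (-‖x - z‖^2 / (2 * (a + b)))) *
      ENNReal.ofReal (Real.exp (-((a + b) / (2 * a * b)) *
        ‖y - ((b / (a+b)) • x + (a / (a+b)) • z)‖^2)) := by
    intro y
    rw [← ENNReal.ofReal_mul (gk_nonneg ha _), ← ENNReal.ofReal_mul (by positivity)]
    congr 1
    unfold gk
    have : -‖x - y‖^2 / (2 * a) + -‖y - z‖^2 / (2 * b) = -‖x - z‖^2 / (2 * (a + b)) +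
        -((a + b) / (2 * a * b)) * ‖y - ((b / (a+b)) • x + (a / (a+b)) • z)‖^2 := by
      have hab : a + b ≠ 0 := by positivity
      simp only [← real_inner_self_eq_norm_sq, inner_sub_left, inner_sub_right, inner_add_left,
        inner_add_right, real_inner_smul_left, real_inner_smul_right, real_inner_comm x y,
        real_inner_comm z y, real_inner_comm z x]
      field_simp
      ring
    calc _ = (2 * π * a) ^ (-(d:ℝ)/2) * (2 * π * b) ^ (-(d:ℝ)/2) *
        Real.exp (-‖x - y‖^2 / (2 * a) + -‖y - z‖^2 / (2 * b)) := by rw [Real.exp_add]; ring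
      _ = _ := by rw [this, Real.exp_add]; ring
  simp_rw [key]
  rw [lintegral_const_mul _ (by fun_prop), gauss_pos (by positivity),
    ← ENNReal.ofReal_mul (by positivity)]
  congr 1
  unfold gk
  have : (2 * π * a) ^ (-(d:ℝ)/2) * (2 * π * b) ^ (-(d:ℝ)/2) *
      (π / ((a + b) / (2 * a * b))) ^ ((d:ℝ)/2) = (2 * π * (a + b)) ^ (-(d:ℝ)/2) := by
    have e : π / ((a + b) / (2 * a * b)) = ((2 * π * a) * (2 * π * b)) * (2 * π * (a + b))⁻¹ := by
      field_simp
    have e2 : (π / ((a + b) / (2 * a * b))) ^ ((d:ℝ)/2) =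
        (2 * π * a) ^ ((d:ℝ)/2) * (2 * π * b) ^ ((d:ℝ)/2) * ((2 * π * (a + b)) ^ ((d:ℝ)/2))⁻¹ := by
      rw [e, Real.mul_rpow (by positivity) (by positivity), Real.mul_rpow (by positivity)
        (by positivity), Real.inv_rpow (by positivity)]
    rw [e2, neg_div, Real.rpow_neg (by positivity), Real.rpow_neg (by positivity),
      Real.rpow_neg (by positivity)]
    have h1 : (2 * π * a) ^ ((d:ℝ)/2) ≠ 0 := by positivity
    have h2 : (2 * π * b) ^ ((d:ℝ)/2) ≠ 0 := by positivity
    generalize (2 * π * a) ^ ((d:ℝ)/2) = u at *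
    generalize (2 * π * b) ^ ((d:ℝ)/2) = v at *
    field_simp
  rw [← this]; ring

lemma gk_shift {d : ℕ} {t : ℝ} (ht : 0 < t) :
    ∃ M : ℝ, 0 ≤ M ∧ ∀ z w : EuclideanSpace ℝ (Fin d), ‖w - z‖ ≤ 1 →
      gk d t z ≤ M * gk d (2*t) w := by
  refine ⟨(2 * π * t) ^ (-(d:ℝ)/2) / (2 * π * (2*t)) ^ (-(d:ℝ)/2) * Real.exp (1 / (2*t)),
    by positivity, fun z w h => ?_⟩
  unfold gk
  have h0 : (0:ℝ) < (2 * π * (2*t)) ^ (-(d:ℝ)/2) := by positivity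
  have : (2 * π * t) ^ (-(d:ℝ)/2) / (2 * π * (2*t)) ^ (-(d:ℝ)/2) * Real.exp (1 / (2*t)) *
      ((2 * π * (2*t)) ^ (-(d:ℝ)/2) * Real.exp (-‖w‖^2 / (2 * (2*t)))) =
      (2 * π * t) ^ (-(d:ℝ)/2) * Real.exp (1 / (2*t) + -‖w‖^2 / (2 * (2*t))) := by
    rw [Real.exp_add]; field_simp
  rw [this]
  refine mul_le_mul_of_nonneg_left (Real.exp_le_exp.2 ?_) (by positivity)
  have hw : ‖w‖ ≤ ‖z‖ + 1 := by
    calc ‖w‖ = ‖z + (w - z)‖ := by simp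
      _ ≤ ‖z‖ + ‖w - z‖ := norm_add_le _ _
      _ ≤ _ := by linarith
  have hw2 : ‖w‖^2 ≤ 2 * ‖z‖^2 + 2 := by
    nlinarith [norm_nonneg w, norm_nonneg z, sq_nonneg (‖z‖ - 1)]
  have : 1 / (2*t) + -‖w‖^2 / (2 * (2*t)) - -‖z‖^2 / (2 * t) =
    (2 * ‖z‖^2 + 2 - ‖w‖^2) / (4 * t) := by field_simp; ring
  have h3 : 0 ≤ (2 * ‖z‖^2 + 2 - ‖w‖^2) / (4 * t) := div_nonneg (by linarith) (by positivity)
  linarith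

/-- heat extension of `|f|` -/
def HH {d : ℕ} (s : ℝ) (f : EuclideanSpace ℝ (Fin d) → ℝ) (x : EuclideanSpace ℝ (Fin d)) : ℝ≥0∞ :=
  ∫⁻ y, ENNReal.ofReal (gk d s (x - y) * |f y|)

lemma HH_le {d : ℕ} (α : ℝ) (f : EuclideanSpace ℝ (Fin d) → ℝ) (x : EuclideanSpace ℝ (Fin d))
    {s : ℝ} (hs : 0 < s) : ENNReal.ofReal ((1 + s) ^ α) * HH s f x ≤ fstar α f x := by
  exact le_iSup₂ (f := fun τ (_ : τ ∈ Set.Ioi (0:ℝ)) => ENNReal.ofReal ((1 + τ) ^ α) * HH τ f x)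
    s hs

lemma HH_lt_top {d : ℕ} {α : ℝ} {f : EuclideanSpace ℝ (Fin d) → ℝ} (hf : MemH0 α f)
    (x : EuclideanSpace ℝ (Fin d)) {s : ℝ} (hs : 0 < s) : HH s f x < ⊤ := by
  have h := (HH_le α f x hs).trans_lt (hf.2 x)
  have h0 : ENNReal.ofReal ((1 + s) ^ α) ≠ 0 := by
    rw [Ne, ENNReal.ofReal_eq_zero, not_le]; positivity
  by_contra hc
  rw [not_lt, top_le_iff] at hc
  rw [hc, ENNReal.mul_top h0] at h
  exact lt_irrefl _ h

lemma HH_integrable {d : ℕ} {α : ℝ} {f : EuclideanSpace ℝ (Fin d) → ℝ} (hf : MemH0 α f)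
    (x : EuclideanSpace ℝ (Fin d)) {s : ℝ} (hs : 0 < s) :
    Integrable (fun y => gk d s (x - y) * |f y|) := by
  have hm : AEStronglyMeasurable f volume := hf.1.aestronglyMeasurable
  refine ⟨?_, ?_⟩
  · exact ((gk_continuous s).comp (continuous_const.sub continuous_id)).aestronglyMeasurable.mul
      hm.norm
  · rw [hasFiniteIntegral_iff_ofReal]
    · exact HH_lt_top hf x hs
    · exact Filter.Eventually.of_forall fun y => mul_nonneg (gk_nonneg hs _) (abs_nonneg _)

section Gen

variable {E : Type} [NormedAddCommGroup E] [NormedSpace ℝ E] [MeasurableSpace E] [BorelSpace E]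
  [SecondCountableTopology E] {μ : Measure E}

/-- curry with a clean type -/
def cL {E : Type} [NormedAddCommGroup E] [NormedSpace ℝ E] {m : ℕ} (φ : E [×(m+1)]→L[ℝ] ℝ) :
    E →L[ℝ] E [×m]→L[ℝ] ℝ := φ.curryLeft

lemma curry_meas {m : ℕ} {φ : E → E [×(m+1)]→L[ℝ] ℝ} (hφ : AEStronglyMeasurable φ μ) :
    AEStronglyMeasurable (fun y => cL (φ y)) μ :=
  (continuousMultilinearCurryLeftEquiv ℝ
      (fun _ : Fin (m + 1) => E) ℝ).continuous.comp_aestronglyMeasurable hφ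

set_option maxSynthPendingDepth 10 in
lemma curry_int {m : ℕ} {φ : E → E [×(m+1)]→L[ℝ] ℝ} (hφ : Integrable φ μ) :
    cL (∫ y, φ y ∂μ) = ∫ y, cL (φ y) ∂μ := by
  have hi : Integrable (fun y => cL (φ y)) μ := by
    refine hφ.mono (curry_meas hφ.1) (Filter.Eventually.of_forall fun y => ?_)
    exact ((continuousMultilinearCurryLeftEquiv ℝ
      (fun _ : Fin (m + 1) => E) ℝ).norm_map (φ y)).le
  ext v w
  rw [cL, ContinuousMultilinearMap.curryLeft_apply, ContinuousMultilinearMap.integral_apply hφ,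
    ContinuousLinearMap.integral_apply hi,
    ContinuousMultilinearMap.integral_apply (hi.apply_continuousLinearMap v)]
  rfl

lemma gen_meas {f g : E → ℝ} (hf : AEStronglyMeasurable f μ) (hg : ∀ n : ℕ, ContDiff ℝ n g)
    (x : E) (m : ℕ) :
    AEStronglyMeasurable (fun y => f y • iteratedFDeriv ℝ m g (x - y)) μ := by
  refine hf.smul (Continuous.aestronglyMeasurable ?_)
  exact ((hg m).continuous_iteratedFDeriv le_rfl).comp (continuous_const.sub continuous_id)

lemma gen_integrable {f g : E → ℝ} (hf : AEStronglyMeasurable f μ)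
    (hg : ∀ n : ℕ, ContDiff ℝ n g)
    (H : ∀ (m : ℕ) (x₀ : E), ∃ bound : E → ℝ, Integrable bound μ ∧ ∀ y, ∀ x ∈ Metric.ball x₀ 1,
      |f y| * ‖iteratedFDeriv ℝ m g (x - y)‖ ≤ bound y) (x : E) (m : ℕ) :
    Integrable (fun y => f y • iteratedFDeriv ℝ m g (x - y)) μ := by
  obtain ⟨bound, hb, h⟩ := H m x
  refine hb.mono' (gen_meas hf hg x m) (Filter.Eventually.of_forall fun y => ?_)
  rw [norm_smul, Real.norm_eq_abs]
  exact h y x (Metric.mem_ball_self one_pos)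

lemma gen_hasFDerivAt {f g : E → ℝ} (hf : AEStronglyMeasurable f μ)
    (hg : ∀ n : ℕ, ContDiff ℝ n g)
    (H : ∀ (m : ℕ) (x₀ : E), ∃ bound : E → ℝ, Integrable bound μ ∧ ∀ y, ∀ x ∈ Metric.ball x₀ 1,
      |f y| * ‖iteratedFDeriv ℝ m g (x - y)‖ ≤ bound y) (x : E) (m : ℕ) :
    HasFDerivAt (fun x => ∫ y, f y • iteratedFDeriv ℝ m g (x - y) ∂μ)
      (cL (∫ y, f y • iteratedFDeriv ℝ (m+1) g (x - y) ∂μ)) x := by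
  obtain ⟨bound, hb, h⟩ := H (m+1) x
  have hdiff : Differentiable ℝ (iteratedFDeriv ℝ m g) :=
    (hg (m+1)).differentiable_iteratedFDeriv (by exact_mod_cast Nat.lt_succ_self m)
  rw [curry_int (gen_integrable hf hg H x (m+1))]
  refine hasFDerivAt_integral_of_dominated_of_fderiv_le (𝕜 := ℝ) (μ := μ) (x₀ := x)
    (s := Metric.ball x 1)
    (F := fun x y => f y • iteratedFDeriv ℝ m g (x - y))
    (F' := fun x y => cL (f y • iteratedFDeriv ℝ (m+1) g (x - y)))
    (bound := bound)
    (Metric.ball_mem_nhds x one_pos)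
    (Filter.Eventually.of_forall fun x => gen_meas hf hg x m) (gen_integrable hf hg H x m)
    (curry_meas (gen_meas hf hg x (m+1)))
    (Filter.Eventually.of_forall fun y x' hx' => ?_)
    hb
    (Filter.Eventually.of_forall fun y x' hx' => ?_)
  · refine ((continuousMultilinearCurryLeftEquiv ℝ
      (fun _ : Fin (m + 1) => E) ℝ).norm_map _).le.trans ?_
    rw [norm_smul, Real.norm_eq_abs]
    exact h y x' hx'
  · have h1 : HasFDerivAt (fun x' => iteratedFDeriv ℝ m g (x' - y))
        (fderiv ℝ (iteratedFDeriv ℝ m g) (x' - y)) x' := by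
      rw [hasFDerivAt_comp_sub]
      exact (hdiff _).hasFDerivAt
    exact h1.const_smul (f y)

lemma gen_series {f g : E → ℝ} (hf : AEStronglyMeasurable f μ)
    (hg : ∀ n : ℕ, ContDiff ℝ n g)
    (H : ∀ (m : ℕ) (x₀ : E), ∃ bound : E → ℝ, Integrable bound μ ∧ ∀ y, ∀ x ∈ Metric.ball x₀ 1,
      |f y| * ‖iteratedFDeriv ℝ m g (x - y)‖ ≤ bound y) (k : ℕ) :
    HasFTaylorSeriesUpTo k (fun x => ∫ y, g (x - y) * f y ∂μ)
      (fun x m => ∫ y, f y • iteratedFDeriv ℝ m g (x - y) ∂μ) := by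
  refine ⟨fun x => ?_, fun m _ x => gen_hasFDerivAt hf hg H x m, fun m _ => ?_⟩
  · rw [ContinuousMultilinearMap.curry0_apply,
      ContinuousMultilinearMap.integral_apply (gen_integrable hf hg H x 0)]
    refine integral_congr_ae (Filter.Eventually.of_forall fun y => ?_)
    simp [mul_comm]
  · exact continuous_iff_continuousAt.2 fun x => (gen_hasFDerivAt hf hg H x m).continuousAt

end Gen

lemma gk_H {d : ℕ} {α : ℝ} {f : EuclideanSpace ℝ (Fin d) → ℝ} (hf : MemH0 α f)
    {t : ℝ} (ht : 0 < t) (m : ℕ) (x : EuclideanSpace ℝ (Fin d)) :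
    ∃ bound : EuclideanSpace ℝ (Fin d) → ℝ, Integrable bound volume ∧
      ∀ y, ∀ x' ∈ Metric.ball x 1,
      |f y| * ‖iteratedFDeriv ℝ m (gk d t) (x' - y)‖ ≤ bound y := by
  obtain ⟨M, hM, hsh⟩ := gk_shift (d := d) (t := 2*t) (by positivity)
  refine ⟨fun y => (((m.factorial : ℝ)^2 * Real.exp 2 * 2 ^ ((d:ℝ)/2)) *
      t ^ (-(m:ℝ)/2) * M) * (gk d (2*(2*t)) (x - y) * |f y|),
      (HH_integrable hf x (by positivity)).const_mul _, fun y x' hx' => ?_⟩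
  simp only
  rw [mul_comm, ← mul_assoc]
  refine mul_le_mul_of_nonneg_right ?_ (abs_nonneg _)
  refine (gk_deriv_bound ht m _).trans ?_
  rw [mul_assoc (_ * _) M]
  gcongr
  apply hsh
  simp only [sub_sub_sub_cancel_right]
  rw [Metric.mem_ball, dist_comm, dist_eq_norm] at hx'
  exact hx'.le

lemma Pt_series {d : ℕ} {α : ℝ} {f : EuclideanSpace ℝ (Fin d) → ℝ} (hf : MemH0 α f)
    {t : ℝ} (ht : 0 < t) (k : ℕ) :
    HasFTaylorSeriesUpTo k (Pt t f)
      (fun x m => ∫ y, f y • iteratedFDeriv ℝ m (gk d t) (x - y)) :=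
  gen_series hf.1.aestronglyMeasurable (fun n => gk_contDiff t n) (gk_H hf ht) k

lemma Pt_deriv_bound {d : ℕ} {α : ℝ} {f : EuclideanSpace ℝ (Fin d) → ℝ} (hf : MemH0 α f)
    {t : ℝ} (ht : 0 < t) (k : ℕ) (x : EuclideanSpace ℝ (Fin d)) :
    ENNReal.ofReal ‖iteratedFDeriv ℝ k (Pt t f) x‖ ≤
      ENNReal.ofReal (((k.factorial : ℝ)^2 * Real.exp 2 * 2 ^ ((d:ℝ)/2)) * t ^ (-(k:ℝ)/2)) *
        HH (2*t) f x := by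
  rw [← (Pt_series hf ht k).eq_iteratedFDeriv le_rfl x, ofReal_norm, HH,
    ← lintegral_const_mul' _ _ ENNReal.ofReal_ne_top]
  refine (enorm_integral_le_lintegral_enorm _).trans (lintegral_mono fun y => ?_)
  rw [← ENNReal.ofReal_mul (by positivity), ← ofReal_norm]
  apply ENNReal.ofReal_le_ofReal
  rw [norm_smul, Real.norm_eq_abs, mul_comm, ← mul_assoc]
  gcongr
  exact gk_deriv_bound ht k _

lemma HH_HH {d : ℕ} {α : ℝ} {f : EuclideanSpace ℝ (Fin d) → ℝ} (hf : MemH0 α f)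
    {a b : ℝ} (ha : 0 < a) (hb : 0 < b) (x : EuclideanSpace ℝ (Fin d)) :
    ∫⁻ y, ENNReal.ofReal (gk d a (x - y)) * HH b f y = HH (a + b) f x := by
  have hm : AEMeasurable f volume := hf.1.aestronglyMeasurable.aemeasurable
  have h1 : ∀ y, ENNReal.ofReal (gk d a (x - y)) * HH b f y =
      ∫⁻ z, ENNReal.ofReal (gk d a (x - y)) * ENNReal.ofReal (gk d b (y - z)) *
        ENNReal.ofReal |f z| := by
    intro y
    rw [HH, ← lintegral_const_mul' _ _ ENNReal.ofReal_ne_top]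
    refine lintegral_congr fun z => ?_
    rw [ENNReal.ofReal_mul (gk_nonneg hb _), mul_assoc]
  have hg1 : Continuous (gk d a) := gk_continuous a
  have hg2 : Continuous (gk d b) := gk_continuous b
  simp_rw [h1]
  rw [lintegral_lintegral_swap]
  · rw [HH]
    refine lintegral_congr fun z => ?_
    rw [lintegral_mul_const' _ _ ENNReal.ofReal_ne_top, semigroup ha hb,
      ENNReal.ofReal_mul (gk_nonneg (by positivity) _)]
  · have hr : AEMeasurable (fun p : EuclideanSpace ℝ (Fin d) × EuclideanSpace ℝ (Fin d) =>
        ENNReal.ofReal |f p.2|) (volume.prod volume) :=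
      ENNReal.measurable_ofReal.comp_aemeasurable (hm.comp_snd (μ := volume)).norm
    have hl : Measurable (fun p : EuclideanSpace ℝ (Fin d) × EuclideanSpace ℝ (Fin d) =>
        ENNReal.ofReal (gk d a (x - p.1)) * ENNReal.ofReal (gk d b (p.1 - p.2))) := by
      fun_prop
    exact hl.aemeasurable.mul hr
/-- Pointwise parabolic estimates: for every `d ≥ 1`, `k ∈ ℕ`, `α ≥ 0` there
is `C > 0` such that for `f ∈ H⁰_α` and `t > 0`, `P_t f` is `k` times differentiable and
`|∇^k(P_t f)(x)| ≤ C t^{-α-k/2} f*_α(x)`, `(∇^k(P_t f))*_α(x) ≤ C t^{-k/2} f*_α(x)`. -/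
theorem statement12 {d : ℕ} (hd : 1 ≤ d) (k : ℕ) (α : ℝ) (hα : 0 ≤ α) :
    ∃ C > (0:ℝ),
      ∀ f : EuclideanSpace ℝ (Fin d) → ℝ, MemH0 α f → ∀ t > (0:ℝ),
        ContDiff ℝ k (Pt t f) ∧
        ∀ x, ‖iteratedFDeriv ℝ k (Pt t f) x‖ ≤
            C * t ^ (-α - (k:ℝ)/2) * (fstar α f x).toReal ∧
          fstar α (fun y => ‖iteratedFDeriv ℝ k (Pt t f) y‖) x ≤
            ENNReal.ofReal (C * t ^ (-(k:ℝ)/2)) * fstar α f x := by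
  set K : ℝ := (k.factorial : ℝ)^2 * Real.exp 2 * 2 ^ ((d:ℝ)/2) with hK
  have hKpos : 0 < K := by positivity
  refine ⟨K, hKpos, fun f hf t ht => ⟨(Pt_series hf ht k).contDiff, fun x => ⟨?_, ?_⟩⟩⟩
  · have h1 := Pt_deriv_bound hf ht k x
    have h2 := HH_le α f x (s := 2*t) (by positivity)
    have hfin := hf.2 x
    have hHfin := HH_lt_top hf x (s := 2*t) (by positivity)
    have h1' : ‖iteratedFDeriv ℝ k (Pt t f) x‖ ≤ K * t ^ (-(k:ℝ)/2) * (HH (2*t) f x).toReal := by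
      have := ENNReal.toReal_mono (ENNReal.mul_ne_top ENNReal.ofReal_ne_top hHfin.ne) h1
      rwa [ENNReal.toReal_mul, ENNReal.toReal_ofReal (norm_nonneg _),
        ENNReal.toReal_ofReal (by positivity)] at this
    have h2' : (1 + 2*t) ^ α * (HH (2*t) f x).toReal ≤ (fstar α f x).toReal := by
      have := ENNReal.toReal_mono hfin.ne h2
      rwa [ENNReal.toReal_mul, ENNReal.toReal_ofReal (by positivity)] at this
    have h3 : t ^ α * (HH (2*t) f x).toReal ≤ (fstar α f x).toReal := by
      refine le_trans ?_ h2'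
      gcongr
      linarith
    have e : t ^ (-α - (k:ℝ)/2) = t ^ (-(k:ℝ)/2) * (t ^ α)⁻¹ := by
      rw [← Real.rpow_neg ht.le, ← Real.rpow_add ht]; congr 1; ring
    refine h1'.trans ?_
    rw [e, ← mul_assoc, mul_assoc (K * _)]
    gcongr
    rw [inv_mul_eq_div, le_div_iff₀ (by positivity), mul_comm]
    exact h3
  · refine iSup₂_le fun τ hτ => ?_
    have hτ' : 0 < τ := hτ
    have h1 : ∫⁻ y, ENNReal.ofReal ((2 * π * τ) ^ (-(d:ℝ)/2) * Real.exp (-‖x - y‖^2 / (2 * τ)) *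
        |‖iteratedFDeriv ℝ k (Pt t f) y‖|) ≤
        ENNReal.ofReal (K * t ^ (-(k:ℝ)/2)) * HH (τ + 2*t) f x := by
      rw [← HH_HH hf hτ' (by positivity) x, ← lintegral_const_mul' _ _ ENNReal.ofReal_ne_top]
      refine lintegral_mono fun y => ?_
      change ENNReal.ofReal (gk d τ (x - y) * |‖iteratedFDeriv ℝ k (Pt t f) y‖|) ≤ _
      rw [abs_norm, ENNReal.ofReal_mul (gk_nonneg hτ' _), mul_left_comm]
      gcongr
      exact Pt_deriv_bound hf ht k y
    calc _ ≤ ENNReal.ofReal ((1 + τ) ^ α) *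
          (ENNReal.ofReal (K * t ^ (-(k:ℝ)/2)) * HH (τ + 2*t) f x) := by gcongr
      _ ≤ ENNReal.ofReal ((1 + (τ + 2*t)) ^ α) *
          (ENNReal.ofReal (K * t ^ (-(k:ℝ)/2)) * HH (τ + 2*t) f x) := by
        gcongr
        linarith
      _ = ENNReal.ofReal (K * t ^ (-(k:ℝ)/2)) *
          (ENNReal.ofReal ((1 + (τ + 2*t)) ^ α) * HH (τ + 2*t) f x) := by
        rw [mul_left_comm]
      _ ≤ _ := by
        gcongr
        exact HH_le α f x (by positivity)
end
end

section
/- Comparison principle for the heat equation in the space H⁰: let ν > 0, T > 0, and let u : [0,T] × ℝ^d → ℝ be continuous, C¹ in time and C² in space on (0,T] × ℝ^d, with ∂ₜu(t,x) ≤ νΔu(t,x) for all (t,x) ∈ (0,T] × ℝ^d, and u(0,·) ≤ 0. Assume that for every x ∈ ℝ^d, sup_{t∈[0,T]} (u(t,·))*(x) < ∞. Then u ≤ 0 on [0,T] × ℝ^d. -/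
open MeasureTheory Real Set
open scoped ENNReal

noncomputable section

/-- The Laplacian of a function `f : ℝ^d → ℝ` at `x`, as the trace of the second derivative. -/
def lapl {d : ℕ} (f : EuclideanSpace ℝ (Fin d) → ℝ) (x : EuclideanSpace ℝ (Fin d)) : ℝ :=
  ∑ i : Fin d,
    iteratedFDeriv ℝ 2 f x ![EuclideanSpace.single i (1:ℝ), EuclideanSpace.single i (1:ℝ)]


theorem second_deriv_test (g : ℝ → ℝ) (hg : ContDiff ℝ 2 g) (x : ℝ) (h : IsLocalMax g x) :
    deriv (deriv g) x ≤ 0 := by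
  by_contra hc
  push Not at hc
  have hd : deriv g x = 0 := h.deriv_eq_zero
  have hmin : IsLocalMin g x := isLocalMin_of_deriv_deriv_pos hc hd hg.continuous.continuousAt
  have hconst : g =ᶠ[nhds x] fun _ => g x := by
    filter_upwards [h, hmin] with y h1 h2 using le_antisymm h1 h2
  have h2 : deriv g =ᶠ[nhds x] deriv (fun _ => g x) := hconst.deriv
  have h3 := h2.deriv_eq
  simp at h3
  linarith

theorem line_second_deriv {E : Type*} [NormedAddCommGroup E] [NormedSpace ℝ E]
    (f : E → ℝ) (hf : ContDiff ℝ 2 f) (x e : E) :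
    deriv (deriv (fun s : ℝ => f (x + s • e))) 0 = iteratedFDeriv ℝ 2 f x ![e, e] := by
  have hl : ∀ s : ℝ, HasDerivAt (fun s : ℝ => x + s • e) e s := fun s => by
    simpa using ((hasDerivAt_id s).smul_const e).const_add x
  have h1 : deriv (fun s : ℝ => f (x + s • e)) = fun s => fderiv ℝ f (x + s • e) e := by
    funext s
    have := ((hf.differentiable (by norm_num)) (x + s • e)).hasFDerivAt.comp_hasDerivAt s (hl s)
    exact this.deriv
  rw [h1, iteratedFDeriv_two_apply]
  have hf' : ContDiff ℝ 1 (fderiv ℝ f) := hf.fderiv_right (by norm_num)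
  have h2 := ((hf'.differentiable (by norm_num)) (x + (0:ℝ) • e)).hasFDerivAt.comp_hasDerivAt
    (0:ℝ) (hl 0)
  have h3 := h2.clm_apply (hasDerivAt_const (0:ℝ) e)
  have := h3.deriv
  simpa using this

/-- The class of classical subsolutions with nonpositive initial data. -/
structure IsSub {d : ℕ} (ν T : ℝ) (u : ℝ → EuclideanSpace ℝ (Fin d) → ℝ) : Prop where
  hcont : ContinuousOn (fun p : ℝ × EuclideanSpace ℝ (Fin d) => u p.1 p.2)
      (Set.Icc 0 T ×ˢ Set.univ)
  hspace : ∀ t ∈ Set.Ioc (0:ℝ) T, ContDiff ℝ 2 (u t)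
  htime : ∀ (x : EuclideanSpace ℝ (Fin d)), ∀ t ∈ Set.Ioc (0:ℝ) T,
      DifferentiableAt ℝ (fun s => u s x) t
  hsub : ∀ t ∈ Set.Ioc (0:ℝ) T, ∀ x, deriv (fun s => u s x) t ≤ ν * lapl (u t) x
  hinit : ∀ x, u 0 x ≤ 0

theorem IsSub.translate {d : ℕ} {ν T : ℝ} {u : ℝ → EuclideanSpace ℝ (Fin d) → ℝ}
    (h : IsSub ν T u) (a : EuclideanSpace ℝ (Fin d)) : IsSub ν T (fun t x => u t (x + a)) where
  hcont := by
    refine h.hcont.comp (f := fun p : ℝ × EuclideanSpace ℝ (Fin d) => (p.1, p.2 + a))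
      (by fun_prop) ?_
    rintro ⟨t, x⟩ hp
    simpa using hp
  hspace t ht := (h.hspace t ht).comp (contDiff_id.add contDiff_const)
  htime x t ht := h.htime (x + a) t ht
  hsub t ht x := by
    have := h.hsub t ht (x + a)
    refine this.trans_eq ?_
    unfold lapl
    simp only [iteratedFDeriv_comp_add_right]
  hinit x := h.hinit _

theorem IsSub.comb {d : ℕ} {ν T : ℝ} {u v : ℝ → EuclideanSpace ℝ (Fin d) → ℝ}
    (hu : IsSub ν T u) (hv : IsSub ν T v) {a b : ℝ} (ha : 0 ≤ a) (hb : 0 ≤ b) :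
    IsSub ν T (fun t x => a * u t x + b * v t x) where
  hcont := (continuousOn_const.mul hu.hcont).add (continuousOn_const.mul hv.hcont)
  hspace t ht := (contDiff_const.mul (hu.hspace t ht)).add (contDiff_const.mul (hv.hspace t ht))
  htime x t ht := ((hu.htime x t ht).const_mul a).add ((hv.htime x t ht).const_mul b)
  hsub t ht x := by
    have h1 : deriv (fun s => a * u s x + b * v s x) t
        = a * deriv (fun s => u s x) t + b * deriv (fun s => v s x) t :=
      (((hu.htime x t ht).hasDerivAt.const_mul a).add
        ((hv.htime x t ht).hasDerivAt.const_mul b)).deriv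
    have h2 : lapl (fun x => a * u t x + b * v t x) x = a * lapl (u t) x + b * lapl (v t) x := by
      unfold lapl
      rw [Finset.mul_sum, Finset.mul_sum, ← Finset.sum_add_distrib]
      refine Finset.sum_congr rfl fun i _ => ?_
      have e : (fun x => a * u t x + b * v t x) = (a • u t) + (b • v t) := by
        funext y; simp
      have c1 := (hu.hspace t ht).contDiffAt (x := x)
      have c2 := (hv.hspace t ht).contDiffAt (x := x)
      rw [e, iteratedFDeriv_add (by exact (hu.hspace t ht).const_smul a)
        (by exact (hv.hspace t ht).const_smul b), Pi.add_apply,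
        iteratedFDeriv_const_smul_apply c1, iteratedFDeriv_const_smul_apply c2]
      simp
    rw [h1, h2]
    have := mul_le_mul_of_nonneg_left (hu.hsub t ht x) ha
    have := mul_le_mul_of_nonneg_left (hv.hsub t ht x) hb
    linarith
  hinit x := by
    have := mul_nonpos_of_nonneg_of_nonpos ha (hu.hinit x)
    have := mul_nonpos_of_nonneg_of_nonpos hb (hv.hinit x)
    linarith

/-- barrier -/
def bar {d : ℕ} (κ ν t : ℝ) (x : EuclideanSpace ℝ (Fin d)) : ℝ :=
  κ * Real.exp (2 * ν * t) * ∑ i, Real.cosh (x i)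

theorem bar_pos {d : ℕ} (hd : 1 ≤ d) {κ : ℝ} (hκ : 0 < κ) (ν t : ℝ)
    (x : EuclideanSpace ℝ (Fin d)) : 0 < bar κ ν t x := by
  unfold bar
  have : Nonempty (Fin d) := ⟨⟨0, hd⟩⟩
  have : 0 < ∑ i, Real.cosh (x i) :=
    Finset.sum_pos (fun i _ => Real.cosh_pos _) Finset.univ_nonempty
  positivity

theorem IsSub.maxprinc {d : ℕ} (hd : 1 ≤ d) {ν T : ℝ} (hν : 0 < ν) (_hT : 0 < T)
    {u : ℝ → EuclideanSpace ℝ (Fin d) → ℝ} (hu : IsSub ν T u) {κ R : ℝ} (hκ : 0 < κ)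
    (hbd : ∀ t ∈ Set.Icc (0:ℝ) T, ∀ x, ‖x‖ = R → u t x < bar κ ν t x) :
    ∀ t ∈ Set.Icc (0:ℝ) T, ∀ x, ‖x‖ ≤ R → u t x ≤ bar κ ν t x := by
  intro t₁ ht₁ x₁ hx₁
  have hcomp : IsCompact (Set.Icc (0:ℝ) T ×ˢ Metric.closedBall (0:EuclideanSpace ℝ (Fin d)) R) :=
    isCompact_Icc.prod (isCompact_closedBall _ _)
  have hbc : Continuous (fun p : ℝ × EuclideanSpace ℝ (Fin d) => bar κ ν p.1 p.2) := by
    unfold bar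
    fun_prop
  obtain ⟨⟨t, x⟩, ⟨ht, hx⟩, hmax⟩ := hcomp.exists_isMaxOn ⟨(t₁, x₁), ht₁, by simpa using hx₁⟩
    ((hu.hcont.mono (Set.prod_mono_right (Set.subset_univ _))).sub hbc.continuousOn)
  simp only at ht hx
  by_contra hcon
  push Not at hcon
  have hpos : 0 < u t x - bar κ ν t x := by
    have := hmax (a := (t₁, x₁)) ⟨ht₁, by simpa using hx₁⟩
    simp at this
    linarith
  have ht0 : 0 < t := by
    rcases ht.1.lt_or_eq with h | h
    · exact h
    · subst h
      have := hu.hinit x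
      have := bar_pos hd hκ ν 0 x
      linarith
  have hxR : ‖x‖ < R := by
    have h1 : ‖x‖ ≤ R := by simpa using hx
    rcases h1.lt_or_eq with h | h
    · exact h
    · have := hbd t ht x h
      linarith
  have htT : t ∈ Set.Ioc (0:ℝ) T := ⟨ht0, ht.2⟩
  have hM : ∀ s ∈ Set.Icc (0:ℝ) T, ∀ y, ‖y‖ ≤ R →
      u s y - bar κ ν s y ≤ u t x - bar κ ν t x := by
    intro s hs y hy
    exact hmax (a := (s, y)) ⟨hs, by simpa using hy⟩
  -- time derivative
  have htd : 2 * ν * bar κ ν t x ≤ deriv (fun s => u s x) t := by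
    have hb : HasDerivAt (fun s => bar κ ν s x) (2 * ν * bar κ ν t x) t := by
      unfold bar
      have h1 : HasDerivAt (fun s : ℝ => Real.exp (2 * ν * s)) (Real.exp (2 * ν * t) * (2 * ν)) t := by
        have := ((hasDerivAt_id t).const_mul (2 * ν)).exp
        simpa using this
      have := (h1.const_mul κ).mul_const (∑ i, Real.cosh (x i))
      refine this.congr_deriv ?_
      ring
    have hW := (hu.htime x t htT).hasDerivAt.sub hb
    have hW' := hW.hasDerivWithinAt (s := Set.Iio t)
    rw [hasDerivWithinAt_iff_tendsto_slope' (by simp)] at hW'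
    have : 0 ≤ deriv (fun s => u s x) t - 2 * ν * bar κ ν t x := by
      refine ge_of_tendsto hW' ?_
      have : ∀ᶠ s in nhdsWithin t (Set.Iio t), 0 < s :=
        nhdsWithin_le_nhds (lt_mem_nhds ht0)
      filter_upwards [this, self_mem_nhdsWithin] with s hs hst
      rw [slope_def_field]
      have hst' : s < t := hst
      have := hM s ⟨hs.le, hst'.le.trans ht.2⟩ x hxR.le
      apply div_nonneg_of_nonpos
      · simp only [Pi.sub_apply]; linarith
      · linarith
    linarith
  -- second derivatives
  have hsd : ∀ i : Fin d, iteratedFDeriv ℝ 2 (u t) x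
      ![EuclideanSpace.single i (1:ℝ), EuclideanSpace.single i (1:ℝ)]
      ≤ κ * Real.exp (2 * ν * t) * Real.cosh (x i) := by
    intro i
    set e : EuclideanSpace ℝ (Fin d) := EuclideanSpace.single i (1:ℝ) with he
    set c := κ * Real.exp (2 * ν * t) with hc
    rw [← line_second_deriv (u t) (hu.hspace t htT) x e]
    set f : ℝ → ℝ := fun s => u t (x + s • e) with hf
    have hfC : ContDiff ℝ 2 f :=
      (hu.hspace t htT).comp (contDiff_const.add (contDiff_id.smul contDiff_const))
    set g : ℝ → ℝ := fun s => c * Real.cosh (x i + s) with hg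
    have hgC : ContDiff ℝ 2 g :=
      contDiff_const.mul (Real.contDiff_cosh.comp (contDiff_const.add contDiff_id))
    have hbar : ∀ s : ℝ, bar κ ν t (x + s • e) - bar κ ν t x = g s - g 0 := by
      intro s
      unfold bar
      rw [← mul_sub, ← Finset.sum_sub_distrib, Finset.sum_eq_single i]
      · simp [he, hg]; ring
      · intro j _ hj
        simp [he, hj]
      · simp
    have hloc : IsLocalMax (f - g) 0 := by
      have hcs : Continuous (fun s : ℝ => ‖x + s • e‖) := by fun_prop
      have : ∀ᶠ s in nhds (0:ℝ), ‖x + s • e‖ < R :=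
        hcs.continuousAt.eventually_lt continuousAt_const (by simpa using hxR)
      filter_upwards [this] with s hs
      have h1 := hM t ht _ hs.le
      have h2 := hbar s
      simp only [Pi.sub_apply, hf]
      simp only [zero_smul, add_zero]
      linarith
    have h2 := second_deriv_test (f - g) (hfC.sub hgC) 0 hloc
    have hg1 : deriv g = fun s => c * Real.sinh (x i + s) := by
      funext s
      have := (((hasDerivAt_id s).const_add (x i)).cosh).const_mul c
      rw [hg]
      refine this.deriv.trans ?_
      simp
    have hg2 : deriv (deriv g) 0 = c * Real.cosh (x i) := by
      rw [hg1]
      have := (((hasDerivAt_id (0:ℝ)).const_add (x i)).sinh).const_mul c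
      simpa using this.deriv
    have h3 : deriv (f - g) = deriv f - deriv g := by
      funext s
      exact deriv_sub (hfC.differentiable (by norm_num) s) (hgC.differentiable (by norm_num) s)
    have hd1 : Differentiable ℝ (deriv f) :=
      (ContDiff.differentiable_deriv_two hfC)
    have hd2 : Differentiable ℝ (deriv g) :=
      (ContDiff.differentiable_deriv_two hgC)
    rw [h3, deriv_sub (hd1 0) (hd2 0), hg2] at h2
    linarith
  have hl : lapl (u t) x ≤ bar κ ν t x := by
    unfold lapl bar
    rw [Finset.mul_sum]
    exact Finset.sum_le_sum fun i _ => hsd i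
  have := hu.hsub t htT x
  have hb := mul_pos hν (bar_pos hd hκ ν t x)
  have := mul_le_mul_of_nonneg_left hl hν.le
  linarith

theorem IsSub.avg_le {d : ℕ} (hd : 1 ≤ d) {ν T : ℝ} (hν : 0 < ν) (hT : 0 < T)
    {u : ℝ → EuclideanSpace ℝ (Fin d) → ℝ} (hu : IsSub ν T u) {κ R ε : ℝ} (hκ : 0 < κ)
    (hε : 0 < ε)
    (hbd : ∀ t ∈ Set.Icc (0:ℝ) T, ∀ x, ‖x‖ = R →
      (⨍ y in Metric.closedBall (0 : EuclideanSpace ℝ (Fin d)) ε, u t (x + y)) < bar κ ν t x) :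
    ∀ t ∈ Set.Icc (0:ℝ) T, ∀ x, ‖x‖ ≤ R →
      (⨍ y in Metric.closedBall (0 : EuclideanSpace ℝ (Fin d)) ε, u t (x + y)) ≤ bar κ ν t x := by
  intro t ht x hx
  have : CompactSpace (Metric.closedBall (0:(EuclideanSpace ℝ (Fin d))) R) :=
    isCompact_iff_compactSpace.mp (isCompact_closedBall _ _)
  have hΦ : Continuous (fun p : (EuclideanSpace ℝ (Fin d)) × (Set.Icc (0:ℝ) T × Metric.closedBall (0:(EuclideanSpace ℝ (Fin d))) R) => u (p.2.1 : ℝ) ((p.2.2 : (EuclideanSpace ℝ (Fin d))) + p.1)) := by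
    refine hu.hcont.comp_continuous
      (f := fun p : (EuclideanSpace ℝ (Fin d)) × (Set.Icc (0:ℝ) T × Metric.closedBall (0:(EuclideanSpace ℝ (Fin d))) R) => ((p.2.1 : ℝ), (p.2.2 : (EuclideanSpace ℝ (Fin d))) + p.1)) (by fun_prop) ?_
    intro p
    exact ⟨p.2.1.2, Set.mem_univ _⟩
  let F : C((EuclideanSpace ℝ (Fin d)), C((Set.Icc (0:ℝ) T × Metric.closedBall (0:(EuclideanSpace ℝ (Fin d))) R), ℝ)) := ContinuousMap.curry ⟨_, hΦ⟩
  have hF : ∀ y k, F y k = u (k.1 : ℝ) ((k.2 : (EuclideanSpace ℝ (Fin d))) + y) := fun y k => rfl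
  let S : Set C((Set.Icc (0:ℝ) T × Metric.closedBall (0:(EuclideanSpace ℝ (Fin d))) R), ℝ) := {v | ∃ V : ℝ → (EuclideanSpace ℝ (Fin d)) → ℝ, IsSub ν T V ∧ ∀ k : (Set.Icc (0:ℝ) T × Metric.closedBall (0:(EuclideanSpace ℝ (Fin d))) R), v k = V (k.1 : ℝ) (k.2 : (EuclideanSpace ℝ (Fin d)))}
  have hS : Convex ℝ S := by
    rintro v ⟨V, hV, hv⟩ w ⟨W, hW, hw⟩ a b ha hb -
    exact ⟨_, hV.comb hW ha hb, fun k => by simp [hv, hw]⟩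
  have hFS : ∀ y, F y ∈ S := fun y => ⟨_, hu.translate y, fun k => rfl⟩
  have hint : IntegrableOn (fun y => F y) (Metric.closedBall (0:(EuclideanSpace ℝ (Fin d))) ε) volume :=
    F.continuous.continuousOn.integrableOn_compact (isCompact_closedBall _ _)
  have h0 : volume (Metric.closedBall (0:(EuclideanSpace ℝ (Fin d))) ε) ≠ 0 :=
    (Metric.measure_closedBall_pos volume _ hε).ne'
  have hA := hS.set_average_mem_closure h0 measure_closedBall_lt_top.ne
    (Filter.Eventually.of_forall hFS) hint
  set A := ⨍ y in Metric.closedBall (0:(EuclideanSpace ℝ (Fin d))) ε, F y with hAdef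
  have hAk : ∀ k : (Set.Icc (0:ℝ) T × Metric.closedBall (0:(EuclideanSpace ℝ (Fin d))) R), A k = ⨍ y in Metric.closedBall (0:(EuclideanSpace ℝ (Fin d))) ε, u (k.1 : ℝ) ((k.2 : (EuclideanSpace ℝ (Fin d))) + y) := by
    intro k
    rw [hAdef, setAverage_eq, setAverage_eq]
    have := (ContinuousMap.evalCLM ℝ k).integral_comp_comm hint
    simp only [ContinuousMap.evalCLM_apply] at this
    rw [ContinuousMap.smul_apply, ← this]
    rfl
  let b : C((Set.Icc (0:ℝ) T × Metric.closedBall (0:(EuclideanSpace ℝ (Fin d))) R), ℝ) := ⟨fun k => bar κ ν (k.1 : ℝ) (k.2 : (EuclideanSpace ℝ (Fin d))), by unfold bar; fun_prop⟩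
  let L : Set (Set.Icc (0:ℝ) T × Metric.closedBall (0:(EuclideanSpace ℝ (Fin d))) R) := {k | ‖(k.2 : (EuclideanSpace ℝ (Fin d)))‖ = R}
  have hL : IsCompact L := by
    apply IsClosed.isCompact
    exact isClosed_eq (by fun_prop) continuous_const
  let O : Set C((Set.Icc (0:ℝ) T × Metric.closedBall (0:(EuclideanSpace ℝ (Fin d))) R), ℝ) := {v | Set.MapsTo (v - b) L (Set.Iio 0)}
  have hO : IsOpen O := by
    have h1 := ContinuousMap.isOpen_setOfPred_mapsTo (X := (Set.Icc (0:ℝ) T × Metric.closedBall (0:(EuclideanSpace ℝ (Fin d))) R)) (Y := ℝ) hL (isOpen_Iio (a := (0:ℝ)))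
    exact h1.preimage (f := fun v : C((Set.Icc (0:ℝ) T × Metric.closedBall (0:(EuclideanSpace ℝ (Fin d))) R), ℝ) => v - b) (by fun_prop)
  let G : Set C((Set.Icc (0:ℝ) T × Metric.closedBall (0:(EuclideanSpace ℝ (Fin d))) R), ℝ) := {v | ∀ k, v k ≤ b k}
  have hG : IsClosed G := by
    have : G = ⋂ k, {v : C((Set.Icc (0:ℝ) T × Metric.closedBall (0:(EuclideanSpace ℝ (Fin d))) R), ℝ) | v k ≤ b k} := by
      ext v; simp [G]
    rw [this]
    refine isClosed_iInter fun k => isClosed_le (by fun_prop) continuous_const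
  have hsub : O ∩ S ⊆ G := by
    rintro v ⟨hvO, V, hV, hv⟩ k
    rw [hv]
    refine hV.maxprinc hd hν hT (R := R) hκ ?_ k.1 k.1.2 k.2 (mem_closedBall_zero_iff.mp k.2.2)
    intro s hs z hz
    have hk := hvO (x := ((⟨s, hs⟩, ⟨z, by simp [hz]⟩) : (Set.Icc (0:ℝ) T × Metric.closedBall (0:(EuclideanSpace ℝ (Fin d))) R))) hz
    simp only [Set.mem_Iio, ContinuousMap.sub_apply, sub_neg] at hk
    rw [hv] at hk
    exact hk
  have hAO : A ∈ O := by
    intro k hk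
    simp only [Set.mem_Iio, ContinuousMap.sub_apply, sub_neg]
    rw [hAk]
    exact hbd _ k.1.2 _ hk
  have hAG : A ∈ G := closure_minimal hsub hG (hO.inter_closure ⟨hAO, hA⟩)
  have := hAG ((⟨t, ht⟩, ⟨x, by simpa using hx⟩) : (Set.Icc (0:ℝ) T × Metric.closedBall (0:(EuclideanSpace ℝ (Fin d))) R))
  rw [hAk] at this
  exact this

theorem avg_bound {d : ℕ} (f : EuclideanSpace ℝ (Fin d) → ℝ) (hf : Continuous f) {ε : ℝ}
    (hε1 : ε ≤ 1) {A : ℝ≥0∞} (hA : A < ⊤) (hfA : fstar 0 f 0 ≤ A)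
    (x : EuclideanSpace ℝ (Fin d)) :
    (⨍ y in Metric.closedBall (0 : EuclideanSpace ℝ (Fin d)) ε, f (x + y)) ≤
      ((volume.real (Metric.closedBall (0 : EuclideanSpace ℝ (Fin d)) ε))⁻¹ *
        (Real.exp (1/2) * (2 * π) ^ ((d:ℝ)/2) * A.toReal)) * (‖x‖ + 1) ^ d := by
  set B := Metric.closedBall (0 : EuclideanSpace ℝ (Fin d)) ε with hB
  set r := ‖x‖ + 1 with hr
  have hr0 : 0 < r := by positivity
  have hker : (∫⁻ y, ENNReal.ofReal ((2 * π * r^2) ^ (-(d:ℝ)/2) *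
      Real.exp (-‖(0:EuclideanSpace ℝ (Fin d)) - y‖^2 / (2 * r^2)) * |f y|)) ≤ A := by
    refine le_trans ?_ hfA
    unfold fstar
    refine le_trans ?_ (le_iSup₂ (r^2) (show r^2 ∈ Set.Ioi (0:ℝ) from pow_pos hr0 2))
    simp
  set D := Real.exp (1/2) * (2 * π) ^ ((d:ℝ)/2) * r ^ d with hD
  have hD0 : 0 ≤ D := by positivity
  have hpt : ∀ z : EuclideanSpace ℝ (Fin d), ‖z‖ ≤ r → |f z| ≤ D *
      ((2 * π * r^2) ^ (-(d:ℝ)/2) *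
      Real.exp (-‖(0:EuclideanSpace ℝ (Fin d)) - z‖^2 / (2 * r^2)) * |f z|) := by
    intro z hz
    have h1 : (2 * π * r^2) ^ (-(d:ℝ)/2) = ((2 * π) ^ ((d:ℝ)/2) * r ^ d)⁻¹ := by
      rw [neg_div, Real.rpow_neg (by positivity), Real.mul_rpow (by positivity) (by positivity)]
      congr 2
      rw [← Real.rpow_natCast r 2, ← Real.rpow_mul hr0.le, ← Real.rpow_natCast r d]
      congr 1
      push_cast
      ring
    have h2 : Real.exp (-(1/2)) ≤ Real.exp (-‖(0:EuclideanSpace ℝ (Fin d)) - z‖^2 / (2 * r^2)) := by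
      apply Real.exp_le_exp.mpr
      rw [zero_sub, norm_neg, neg_div, neg_le_neg_iff, div_le_div_iff₀ (by positivity) (by positivity)]
      have : ‖z‖^2 ≤ r^2 := by gcongr
      linarith
    rw [h1, hD]
    have h3 : (2 * π) ^ ((d:ℝ)/2) * r ^ d ≠ 0 := by positivity
    calc |f z| = Real.exp (1/2) * Real.exp (-(1/2)) * |f z| := by
          rw [← Real.exp_add]; simp
      _ ≤ Real.exp (1/2) * Real.exp (-‖(0:EuclideanSpace ℝ (Fin d)) - z‖^2 / (2 * r^2)) * |f z| := by
          gcongr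
      _ = _ := by
          rw [mul_assoc (Real.exp (1/2)) ((2 * π) ^ ((d:ℝ)/2)) (r ^ d)]
          generalize (2 * π) ^ ((d:ℝ)/2) * r ^ d = q at h3
          field_simp
  have hl : (∫⁻ y in B, ENNReal.ofReal |f (x + y)|) ≤ ENNReal.ofReal D * A := by
    set k : EuclideanSpace ℝ (Fin d) → ℝ≥0∞ := fun y => ENNReal.ofReal ((2 * π * r^2) ^ (-(d:ℝ)/2) *
      Real.exp (-‖(0:EuclideanSpace ℝ (Fin d)) - y‖^2 / (2 * r^2)) * |f y|) with hk
    calc (∫⁻ y in B, ENNReal.ofReal |f (x + y)|)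
        ≤ ∫⁻ y in B, ENNReal.ofReal D * k (x + y) := by
          refine setLIntegral_mono' Metric.isClosed_closedBall.measurableSet fun y hy => ?_
          rw [hk, ← ENNReal.ofReal_mul hD0]
          apply ENNReal.ofReal_le_ofReal
          apply hpt
          have : ‖y‖ ≤ ε := by simpa [hB] using hy
          exact (norm_add_le _ _).trans (by rw [hr]; linarith)
      _ ≤ ∫⁻ y, ENNReal.ofReal D * k (x + y) := setLIntegral_le_lintegral _ _
      _ = ENNReal.ofReal D * ∫⁻ y, k (x + y) := lintegral_const_mul' _ _ ENNReal.ofReal_ne_top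
      _ = ENNReal.ofReal D * ∫⁻ y, k y := by rw [lintegral_add_left_eq_self k x]
      _ ≤ ENNReal.ofReal D * A := by gcongr
  have hi : (∫ y in B, f (x + y)) ≤ D * A.toReal := by
    have hc : Continuous fun y => f (x + y) := by fun_prop
    have hint : IntegrableOn (fun y => f (x + y)) B volume :=
      hc.continuousOn.integrableOn_compact (isCompact_closedBall _ _)
    calc (∫ y in B, f (x + y)) ≤ ∫ y in B, |f (x + y)| :=
          integral_mono hint hint.abs fun y => le_abs_self _
      _ = (∫⁻ y in B, ENNReal.ofReal |f (x + y)|).toReal := by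
          rw [integral_eq_lintegral_of_nonneg_ae]
          · exact Filter.Eventually.of_forall fun y => abs_nonneg _
          · exact hint.abs.aestronglyMeasurable
      _ ≤ (ENNReal.ofReal D * A).toReal :=
          ENNReal.toReal_mono (ENNReal.mul_ne_top ENNReal.ofReal_ne_top hA.ne) hl
      _ = D * A.toReal := by rw [ENNReal.toReal_mul, ENNReal.toReal_ofReal hD0]
  rw [setAverage_eq, smul_eq_mul]
  calc _ ≤ (volume.real B)⁻¹ * (D * A.toReal) := by gcongr
    _ = _ := by rw [hD]; ring

theorem bar_lower {d : ℕ} (hd : 1 ≤ d) {κ ν t : ℝ} (hκ : 0 < κ) (hν : 0 < ν) (ht : 0 ≤ t)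
    (x : EuclideanSpace ℝ (Fin d)) : κ * (Real.exp (‖x‖ / d) / 2) ≤ bar κ ν t x := by
  have hne : Nonempty (Fin d) := ⟨⟨0, hd⟩⟩
  have hd0 : (0:ℝ) < d := by exact_mod_cast hd
  obtain ⟨i, hi⟩ : ∃ i, ‖x‖ / d ≤ |x i| := by
    by_contra hcon
    push Not at hcon
    have h1 : ‖x‖ ≤ ∑ i, |x i| := by
      rw [EuclideanSpace.norm_eq]
      apply Real.sqrt_le_iff.mpr
      refine ⟨Finset.sum_nonneg fun i _ => abs_nonneg _, ?_⟩
      simpa using Finset.sum_sq_le_sq_sum_of_nonneg (s := Finset.univ) (f := fun i => |x i|)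
        (fun i _ => abs_nonneg _)
    have h2 : ∑ i, |x i| < ∑ i : Fin d, ‖x‖ / d :=
      Finset.sum_lt_sum_of_nonempty Finset.univ_nonempty fun i _ => hcon i
    simp at h2
    rw [mul_div_cancel₀ _ hd0.ne'] at h2
    linarith
  have h1 : Real.exp (‖x‖ / d) / 2 ≤ Real.cosh (x i) := by
    rw [← Real.cosh_abs, Real.cosh_eq]
    have := Real.exp_le_exp.mpr hi
    have := Real.exp_pos (-|x i|)
    linarith
  have h2 : Real.cosh (x i) ≤ ∑ i, Real.cosh (x i) :=
    Finset.single_le_sum (f := fun i => Real.cosh (x i)) (fun j _ => (Real.cosh_pos _).le)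
      (Finset.mem_univ i)
  unfold bar
  have h3 : 1 ≤ Real.exp (2 * ν * t) := Real.one_le_exp (by positivity)
  rw [mul_assoc]
  gcongr
  have : 0 < ∑ i, Real.cosh (x i) := (Real.cosh_pos _).trans_le h2
  nlinarith

theorem exists_large (d : ℕ) (hd : 1 ≤ d) (C δ R₀ : ℝ) (hδ : 0 < δ) :
    ∃ R ≥ R₀, C * (R + 1) ^ d < δ * Real.exp (R / d) := by
  have hd0 : (0:ℝ) < d := by exact_mod_cast hd
  have h1 := Real.tendsto_exp_div_pow_atTop d
  have h2 : Filter.Tendsto (fun R : ℝ => (R + 1) / d) Filter.atTop Filter.atTop :=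
    (Filter.tendsto_atTop_add_const_right _ _ Filter.tendsto_id).atTop_div_const hd0
  have h3 := (h1.comp h2).eventually_gt_atTop (C * d ^ d * Real.exp (1 / d) / δ)
  obtain ⟨R, ⟨hR, hR0⟩, hR1⟩ :=
    ((h3.and (Filter.eventually_ge_atTop R₀)).and (Filter.eventually_ge_atTop 0)).exists
  refine ⟨R, hR0, ?_⟩
  simp only [Function.comp] at hR
  have hp : 0 < ((R + 1) / d) ^ d := by positivity
  rw [div_lt_div_iff₀ hδ hp, div_pow, add_div, Real.exp_add] at hR
  have e : C * d ^ d * Real.exp (1 / d) * ((R + 1) ^ d / d ^ d)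
      = (C * (R + 1) ^ d) * Real.exp (1 / d) := by
    field_simp
  rw [e] at hR
  have h5 := Real.exp_pos (1 / (d:ℝ))
  have : (C * (R + 1) ^ d) * Real.exp (1 / d) < (δ * Real.exp (R / d)) * Real.exp (1 / d) := by
    linarith
  exact lt_of_mul_lt_mul_right this h5.le

/-- Comparison principle for the heat equation in `H⁰`: a classical
subsolution `u` of the heat equation on `[0,T] × ℝ^d` with `u(0,·) ≤ 0` and
`sup_{t∈[0,T]} (u(t,·))*(x) < ∞` for every `x` satisfies `u ≤ 0` on `[0,T] × ℝ^d`. -/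
theorem statement13 {d : ℕ} (hd : 1 ≤ d) (ν T : ℝ) (hν : 0 < ν) (hT : 0 < T)
    (u : ℝ → EuclideanSpace ℝ (Fin d) → ℝ)
    (hcont : ContinuousOn (fun p : ℝ × EuclideanSpace ℝ (Fin d) => u p.1 p.2)
      (Set.Icc 0 T ×ˢ Set.univ))
    (hspace : ∀ t ∈ Set.Ioc (0:ℝ) T, ContDiff ℝ 2 (u t))
    (htime : ∀ (x : EuclideanSpace ℝ (Fin d)), ∀ t ∈ Set.Ioc (0:ℝ) T,
      DifferentiableAt ℝ (fun s => u s x) t)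
    (hsub : ∀ t ∈ Set.Ioc (0:ℝ) T, ∀ x, deriv (fun s => u s x) t ≤ ν * lapl (u t) x)
    (hinit : ∀ x, u 0 x ≤ 0)
    (hstar : ∀ x, (⨆ t ∈ Set.Icc (0:ℝ) T, fstar 0 (u t) x) < ⊤) :
    ∀ t ∈ Set.Icc (0:ℝ) T, ∀ x, u t x ≤ 0 := by
  have hu : IsSub ν T u := ⟨hcont, hspace, htime, hsub, hinit⟩
  intro t ht x
  by_contra hpos
  push Not at hpos
  have hct : ∀ s ∈ Set.Icc (0:ℝ) T, Continuous (u s) := by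
    intro s hs
    exact hcont.comp_continuous (f := fun y => (s, y)) (by fun_prop) fun y => ⟨hs, Set.mem_univ _⟩
  obtain ⟨ε', hε', hball⟩ := Metric.eventually_nhds_iff.mp
    ((hct t ht).continuousAt.eventually (lt_mem_nhds hpos))
  set ε := min (ε' / 2) 1 with hεdef
  have hε : 0 < ε := by positivity
  have hε1 : ε ≤ 1 := min_le_right _ _
  have hεε : ε < ε' := (min_le_left _ _).trans_lt (by linarith)
  set A := ⨆ t ∈ Set.Icc (0:ℝ) T, fstar 0 (u t) 0 with hA
  have hAt : A < ⊤ := hstar 0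
  have hle : ∀ κ > 0,
      (⨍ y in Metric.closedBall (0 : EuclideanSpace ℝ (Fin d)) ε, u t (x + y)) ≤ bar κ ν t x := by
    intro κ hκ
    obtain ⟨R, hR, hR'⟩ := exists_large d hd
      ((volume.real (Metric.closedBall (0 : EuclideanSpace ℝ (Fin d)) ε))⁻¹ *
        (Real.exp (1/2) * (2 * π) ^ ((d:ℝ)/2) * A.toReal)) (κ / 2) ‖x‖ (by positivity)
    refine hu.avg_le hd hν hT hκ hε (R := R) ?_ t ht x hR
    intro s hs z hz
    have h1 := avg_bound (u s) (hct s hs) hε1 hAt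
      (le_iSup₂ (f := fun t (_ : t ∈ Set.Icc (0:ℝ) T) => fstar 0 (u t) 0) s hs) z
    have h2 := bar_lower hd hκ hν hs.1 z
    rw [hz] at h1 h2
    linarith
  have hint : 0 < ∫ y in Metric.closedBall (0 : EuclideanSpace ℝ (Fin d)) ε, u t (x + y) := by
    have hc : Continuous fun y => u t (x + y) := (hct t ht).comp (by fun_prop)
    have hp : ∀ y ∈ Metric.closedBall (0 : EuclideanSpace ℝ (Fin d)) ε, 0 < u t (x + y) := by
      intro y hy
      apply hball
      have : ‖y‖ ≤ ε := by simpa using hy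
      simpa using this.trans_lt hεε
    rw [setIntegral_pos_iff_support_of_nonneg_ae]
    · refine (Metric.measure_closedBall_pos volume (0 : EuclideanSpace ℝ (Fin d)) hε).trans_le
        (measure_mono fun y hy => ⟨(hp y hy).ne', hy⟩)
    · exact (ae_restrict_iff' Metric.isClosed_closedBall.measurableSet).mpr
        (Filter.Eventually.of_forall fun y hy => (hp y hy).le)
    · exact hc.continuousOn.integrableOn_compact (isCompact_closedBall _ _)
  have hM : 0 < ⨍ y in Metric.closedBall (0 : EuclideanSpace ℝ (Fin d)) ε, u t (x + y) := by
    rw [setAverage_eq, smul_eq_mul]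
    have : 0 < volume.real (Metric.closedBall (0 : EuclideanSpace ℝ (Fin d)) ε) :=
      ENNReal.toReal_pos (Metric.measure_closedBall_pos volume _ hε).ne'
        measure_closedBall_lt_top.ne
    positivity
  set M := ⨍ y in Metric.closedBall (0 : EuclideanSpace ℝ (Fin d)) ε, u t (x + y) with hMdef
  have hb1 := bar_pos hd one_pos ν t x
  have h := hle (M / (2 * bar 1 ν t x)) (by positivity)
  have hb : bar (M / (2 * bar 1 ν t x)) ν t x = M / (2 * bar 1 ν t x) * bar 1 ν t x := by
    unfold bar; ring
  rw [hb] at h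
  have : M / (2 * bar 1 ν t x) * bar 1 ν t x = M / 2 := by field_simp
  linarith
end
end

section
/- Let V satisfy the standing assumptions, let ν, λ > 0, μ ∈ (0,1), T > 0, and let U, Ū : [0,T] × ℝ^d → ℝ be continuous, C¹ in time and C² in space on (0,T] × ℝ^d, satisfying pointwise on (0,T] × ℝ^d the inequalities ∂ₜU ≤ νΔU + λV(∇U) (subsolution) and ∂ₜŪ ≥ νΔŪ + λV(∇Ū) (supersolution). Then Ψ := U − μŪ satisfies pointwise on (0,T] × ℝ^d the inequality ∂ₜΨ ≤ νΔΨ + (λ/(1−μ))·|∇Ψ|², i.e. Ψ is a subsolution of the quadratic KPZ equation with coupling λ/(1−μ). -/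
open MeasureTheory Real Set
open scoped ENNReal

noncomputable section

/-- Standing assumptions on the deposition rate `V` (with radial profile `W`):
`V` is `C²`, isotropic, convex, `W 0 = 0`, `W ≥ 0` and `W y ≤ y²` on `[0,∞)`. -/
structure IsDepositionRate (d : ℕ) (V : EuclideanSpace ℝ (Fin d) → ℝ) (W : ℝ → ℝ) : Prop where
  smooth : ContDiff ℝ 2 V
  isotropic : ∀ p, V p = W ‖p‖
  convex : ConvexOn ℝ Set.univ V
  zero : W 0 = 0
  nonneg : ∀ y : ℝ, 0 ≤ y → 0 ≤ W y
  quadGrowth : ∀ y : ℝ, 0 ≤ y → W y ≤ y ^ 2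

/-- If `U` is a classical subsolution and `Ū` a classical supersolution of
`∂ₜu = νΔu + λV(∇u)` on `(0,T] × ℝ^d`, then for `μ ∈ (0,1)` the function `Ψ = U - μŪ` is a
classical subsolution of the quadratic KPZ equation
`∂ₜΨ ≤ νΔΨ + (λ/(1-μ))|∇Ψ|²` on `(0,T] × ℝ^d`. -/
theorem statement14 {d : ℕ} (hd : 1 ≤ d)
    (V : EuclideanSpace ℝ (Fin d) → ℝ) (W : ℝ → ℝ) (hV : IsDepositionRate d V W)
    (ν lam T μ : ℝ) (hν : 0 < ν) (hlam : 0 < lam) (hT : 0 < T) (hμ : μ ∈ Set.Ioo (0:ℝ) 1)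
    (U Ubar : ℝ → EuclideanSpace ℝ (Fin d) → ℝ)
    (hUcont : ContinuousOn (fun p : ℝ × EuclideanSpace ℝ (Fin d) => U p.1 p.2)
      (Set.Icc 0 T ×ˢ Set.univ))
    (hUbarcont : ContinuousOn (fun p : ℝ × EuclideanSpace ℝ (Fin d) => Ubar p.1 p.2)
      (Set.Icc 0 T ×ˢ Set.univ))
    (hUspace : ∀ t ∈ Set.Ioc (0:ℝ) T, ContDiff ℝ 2 (U t))
    (hUbarspace : ∀ t ∈ Set.Ioc (0:ℝ) T, ContDiff ℝ 2 (Ubar t))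
    (hUtime : ∀ (x : EuclideanSpace ℝ (Fin d)), ∀ t ∈ Set.Ioc (0:ℝ) T,
      DifferentiableAt ℝ (fun s => U s x) t)
    (hUbartime : ∀ (x : EuclideanSpace ℝ (Fin d)), ∀ t ∈ Set.Ioc (0:ℝ) T,
      DifferentiableAt ℝ (fun s => Ubar s x) t)
    (hUsub : ∀ t ∈ Set.Ioc (0:ℝ) T, ∀ x,
      deriv (fun s => U s x) t ≤ ν * lapl (U t) x + lam * V (gradient (U t) x))
    (hUbarsuper : ∀ t ∈ Set.Ioc (0:ℝ) T, ∀ x,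
      ν * lapl (Ubar t) x + lam * V (gradient (Ubar t) x) ≤ deriv (fun s => Ubar s x) t) :
    ∀ t ∈ Set.Ioc (0:ℝ) T, ∀ x,
      deriv (fun s => U s x - μ * Ubar s x) t ≤
        ν * lapl (fun y => U t y - μ * Ubar t y) x +
        (lam / (1 - μ)) * ‖gradient (fun y => U t y - μ * Ubar t y) x‖ ^ 2 := by
  intro t ht x
  obtain ⟨hμ0, hμ1⟩ := hμ
  have h1μ : 0 < 1 - μ := by linarith
  have hU2 : ContDiffAt ℝ 2 (U t) x := (hUspace t ht).contDiffAt
  have hB2 : ContDiffAt ℝ 2 (Ubar t) x := (hUbarspace t ht).contDiffAt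
  have hD : deriv (fun s => U s x - μ * Ubar s x) t
      = deriv (fun s => U s x) t - μ * deriv (fun s => Ubar s x) t :=
    ((hUtime x t ht).hasDerivAt.sub ((hUbartime x t ht).hasDerivAt.const_mul μ)).deriv
  have hL : lapl (fun y => U t y - μ * Ubar t y) x = lapl (U t) x - μ * lapl (Ubar t) x := by
    have hfun : (fun y => U t y - μ * Ubar t y) = U t + (-μ) • Ubar t := by
      ext y; simp; ring
    have hI : iteratedFDeriv ℝ 2 (U t + (-μ) • Ubar t) x
        = iteratedFDeriv ℝ 2 (U t) x + (-μ) • iteratedFDeriv ℝ 2 (Ubar t) x := by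
      rw [iteratedFDeriv_add_apply (g := (-μ) • Ubar t) hU2 (hB2.const_smul (-μ)), iteratedFDeriv_const_smul_apply hB2]
    unfold lapl
    rw [hfun, hI, Finset.mul_sum, ← Finset.sum_sub_distrib]
    refine Finset.sum_congr rfl fun i _ => ?_
    simp
    ring
  have hUd : DifferentiableAt ℝ (U t) x := hU2.differentiableAt (by norm_num)
  have hBd : DifferentiableAt ℝ (Ubar t) x := hB2.differentiableAt (by norm_num)
  have hG : gradient (fun y => U t y - μ * Ubar t y) x
      = gradient (U t) x - μ • gradient (Ubar t) x := by
    have h := hUd.hasFDerivAt.sub (hBd.hasFDerivAt.const_mul μ)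
    have h' : fderiv ℝ (fun y => U t y - μ * Ubar t y) x
      = fderiv ℝ (U t) x - μ • fderiv ℝ (Ubar t) x := h.fderiv
    unfold gradient
    rw [h', map_sub]
    simp
  rw [hD, hL, hG]
  have h1 := hUsub t ht x
  have h2 := mul_le_mul_of_nonneg_left (hUbarsuper t ht x) hμ0.le
  generalize gradient (U t) x = p at *
  generalize gradient (Ubar t) x = q at *
  have hc := hV.convex.2 (Set.mem_univ q) (Set.mem_univ ((1 - μ)⁻¹ • (p - μ • q))) hμ0.le h1μ.le
    (by ring)
  rw [smul_inv_smul₀ h1μ.ne', add_sub_cancel] at hc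
  have hq : V ((1 - μ)⁻¹ • (p - μ • q)) ≤ ((1 - μ)⁻¹ * ‖p - μ • q‖) ^ 2 := by
    rw [hV.isotropic]
    refine (hV.quadGrowth _ (norm_nonneg _)).trans_eq ?_
    rw [norm_smul, Real.norm_of_nonneg (inv_nonneg.2 h1μ.le)]
  have h3 := mul_le_mul_of_nonneg_left hq h1μ.le
  have h4 : (1 - μ) * ((1 - μ)⁻¹ * ‖p - μ • q‖) ^ 2 = (1 - μ)⁻¹ * ‖p - μ • q‖ ^ 2 := by
    field_simp
  simp only [smul_eq_mul] at hc
  have h5 : V p - μ * V q ≤ (1 - μ)⁻¹ * ‖p - μ • q‖ ^ 2 := by linarith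
  have h6 := mul_le_mul_of_nonneg_left h5 hlam.le
  rw [div_eq_mul_inv, mul_assoc]
  linarith
end
end

section
/- Mayer-expansion inequality: let I be a nonempty finite set with n := |I| ≥ 1, let c₀ > 0, ε > 0, let z : I → [0,∞), and let d : I × I → [0,∞) satisfy d(i,i) = 0 for all i ∈ I. Assume there exist real numbers 0 < d₁ ≤ d₂ ≤ … ≤ d_{n−1} such that for every i ∈ I there is a bijection σᵢ : {1,…,n−1} → I∖{i} with d(i, σᵢ(k)) ≥ d_k for every k ∈ {1,…,n−1}. Define yᵢ := Σ_{j∈I} e^{−c₀·d(i,j)}·z_j for i ∈ I. Then Σ_{i∈I} e^{ε·yᵢ} ≤ ( Σ_{i∈I} e^{ε·zᵢ} )^{1 + Σ_{k=1}^{n−1} e^{−c₀·d_k}}. -/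
open Real

noncomputable section

/-- Mayer-expansion inequality: let `I` be a nonempty finite index type,
`c₀, ε > 0`, `z : I → [0,∞)`, and `dist : I × I → [0,∞)` with `dist i i = 0`. Assume there
are `0 < d₁ ≤ … ≤ d_{n-1}` (`n = |I|`) such that for every `i` there is a bijection
`σᵢ : {1,…,n-1} ≃ I∖{i}` with `dist(i, σᵢ(k)) ≥ d_k` for all `k`. Then, with
`yᵢ = Σⱼ e^{-c₀ dist(i,j)} zⱼ`,
`Σᵢ e^{ε yᵢ} ≤ (Σᵢ e^{ε zᵢ})^{1 + Σ_k e^{-c₀ d_k}}`. -/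
theorem statement19 {I : Type} [Fintype I] [Nonempty I]
    (c₀ ε : ℝ) (hc₀ : 0 < c₀) (hε : 0 < ε)
    (z : I → ℝ) (hz : ∀ i, 0 ≤ z i)
    (dist : I → I → ℝ) (hdist_nonneg : ∀ i j, 0 ≤ dist i j) (hdiag : ∀ i, dist i i = 0)
    (ds : Fin (Fintype.card I - 1) → ℝ) (hds_pos : ∀ k, 0 < ds k) (hds_mono : Monotone ds)
    (hbij : ∀ i : I, ∃ σ : Fin (Fintype.card I - 1) ≃ {j : I // j ≠ i},
      ∀ k, ds k ≤ dist i (σ k : I)) :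
    ∑ i, Real.exp (ε * ∑ j, Real.exp (-c₀ * dist i j) * z j) ≤
      (∑ i, Real.exp (ε * z i)) ^ ((1:ℝ) + ∑ k, Real.exp (-c₀ * ds k)) := by
  classical
  set S := ∑ i, Real.exp (ε * z i) with hS
  have hle : ∀ i, Real.exp (ε * z i) ≤ S := fun i =>
    Finset.single_le_sum (f := fun i => Real.exp (ε * z i))
      (fun j _ => (Real.exp_pos _).le) (Finset.mem_univ i)
  have hSpos : 0 < S := (Real.exp_pos _).trans_le (hle (Classical.arbitrary I))
  have hL : ∀ i, ε * z i ≤ Real.log S := fun i => (Real.le_log_iff_exp_le hSpos).2 (hle i)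
  rw [Real.rpow_add hSpos, Real.rpow_one]
  conv_rhs => rw [hS, Finset.sum_mul]
  refine Finset.sum_le_sum fun i _ => ?_
  rw [← hS, Real.rpow_def_of_pos hSpos, ← Real.exp_add]
  apply Real.exp_le_exp.2
  obtain ⟨σ, hσ⟩ := hbij i
  have h1 : ∑ j, Real.exp (-c₀ * dist i j) * z j
      = z i + ∑ k, Real.exp (-c₀ * dist i (σ k)) * z (σ k) := by
    rw [Fintype.sum_eq_add_sum_subtype_ne _ i, hdiag,
      ← Equiv.sum_comp σ]
    simp
  rw [h1, mul_add, Finset.mul_sum, Finset.mul_sum]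
  refine add_le_add le_rfl (Finset.sum_le_sum fun k _ => ?_)
  have h2 : Real.exp (-c₀ * dist i (σ k)) ≤ Real.exp (-c₀ * ds k) := by
    apply Real.exp_le_exp.2
    nlinarith [hσ k]
  calc ε * (Real.exp (-c₀ * dist i (σ k)) * z (σ k))
      = (ε * z (σ k)) * Real.exp (-c₀ * dist i (σ k)) := by ring
    _ ≤ Real.log S * Real.exp (-c₀ * ds k) :=
      mul_le_mul (hL _) h2 (Real.exp_pos _).le
        ((mul_nonneg hε.le (hz i)).trans (hL i))
end
end
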